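/- arXiv:2106.10096 — 4 statements merged into one kernel-verified Lean document; each statement's English description precedes it below -/
import Mathlib

section
/- Let G be a tree with edge lengths ℓ and V_D = ∅. Then there exists a sequence (ω_n) of positive real numbers with ω_n → ∞ such that det A_{ω_n}(G) = 0 for all n and ‖A_{ω_n}(G) − A_0(G)‖_F → 0 as n → ∞, where ‖·‖_F denotes the Frobenius norm. -/
open Matrix Filter Topology

attribute [local instance] Classical.propDecidable

/-- The secular matrix built from per-edge cosine values `c` and sine values `s`,
for a graph with initial/terminal vertex maps `ι`, `τ` and Dirichlet vertex set `VD`.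
Rows and columns are indexed by `V ⊕ E × Bool`, where `(e, false)` plays the role of
`(e,0)` (initial endpoint data) and `(e, true)` of `(e,1)` (terminal endpoint data). -/
noncomputable def secMatrix {V E : Type} (ι τ : E → V) (VD : Set V)
    (c s : E → ℝ) : Matrix (V ⊕ E × Bool) (V ⊕ E × Bool) ℝ :=
  Matrix.of fun i j =>
    match i, j with
    | Sum.inl v, Sum.inl u =>
        if v ∈ VD then (if u = v then (1 : ℝ) else 0) else 0
    | Sum.inl v, Sum.inr (f, b) =>
        if v ∈ VD then 0
        else if b then (if τ f = v then 1 else 0) else (if ι f = v then 1 else 0)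
    | Sum.inr (e, b), Sum.inl u =>
        if b then (if u = ι e then s e else 0)
        else (if u = τ e then 1 else 0) + (if u = ι e then -(c e) else 0)
    | Sum.inr (e, b), Sum.inr (f, b') =>
        if b then
          (if f = e ∧ b' = false then c e else 0) + (if f = e ∧ b' = true then 1 else 0)
        else if f = e ∧ b' = false then s e else 0

/-- The secular matrix `A_ω(G, V_D)` of a metric graph with edge lengths `ℓ`. -/
noncomputable def secA {V E : Type} (ι τ : E → V) (VD : Set V) (ℓ : E → ℝ) (ω : ℝ) :
    Matrix (V ⊕ E × Bool) (V ⊕ E × Bool) ℝ :=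
  secMatrix ι τ VD (fun e => Real.cos (ℓ e * ω)) (fun e => Real.sin (ℓ e * ω))

/-- Two vertices are adjacent if some edge joins them (in either direction). -/
def GraphAdj {V E : Type} (ι τ : E → V) (u w : V) : Prop :=
  ∃ e : E, (ι e = u ∧ τ e = w) ∨ (ι e = w ∧ τ e = u)

/-- A graph is connected if any two vertices are joined by a walk. -/
def IsConnectedGraph {V E : Type} (ι τ : E → V) : Prop :=
  ∀ u w : V, Relation.ReflTransGen (GraphAdj ι τ) u w

/-- The degree of a vertex: the number of edges incident to it. -/
noncomputable def graphDegree {V E : Type} [Fintype E] (ι τ : E → V) (v : V) : ℕ :=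
  (Finset.univ.filter fun e => ι e = v ∨ τ e = v).card

/-- The Frobenius norm of a real square matrix. -/
noncomputable def frobNorm {n : Type} [Fintype n] (M : Matrix n n ℝ) : ℝ :=
  Real.sqrt (∑ i, ∑ j, (M i j) ^ 2)

lemma continuous_secMatrix {V E : Type} (ι τ : E → V) (VD : Set V) :
    Continuous fun p : (E → ℝ) × (E → ℝ) => secMatrix ι τ VD p.1 p.2 := by
  refine continuous_matrix fun i j => ?_
  rcases i with v | ⟨e, b⟩ <;> rcases j with u | ⟨f, b'⟩ <;> simp only [secMatrix, Matrix.of_apply] <;>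
    split_ifs <;> fun_prop

lemma continuous_frobNorm {n : Type} [Fintype n] :
    Continuous (frobNorm : Matrix n n ℝ → ℝ) := by
  unfold frobNorm
  fun_prop

lemma analyticAt_secA_apply {V E : Type} (ι τ : E → V) (VD : Set V) (ℓ : E → ℝ)
    (i j : V ⊕ E × Bool) (t : ℝ) : AnalyticAt ℝ (fun ω => secA ι τ VD ℓ ω i j) t := by
  rcases i with v | ⟨e, b⟩ <;> rcases j with u | ⟨f, b'⟩ <;>
    simp only [secA, secMatrix, Matrix.of_apply] <;> split_ifs <;> fun_prop

lemma analyticAt_det_secA {V E : Type} [Fintype V] [Fintype E] (ι τ : E → V) (VD : Set V)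
    (ℓ : E → ℝ) (t : ℝ) : AnalyticAt ℝ (fun ω => (secA ι τ VD ℓ ω).det) t := by
  simp only [Matrix.det_apply']
  exact Finset.analyticAt_fun_sum _ fun σ _ => analyticAt_const.mul <|
    Finset.analyticAt_fun_prod _ fun i _ => analyticAt_secA_apply ..

/-- Reversing the sign of `ω` amounts to multiplying `A_ω` by diagonal sign matrices. -/
lemma secA_neg {V E : Type} [Fintype V] [Fintype E] (ι τ : E → V) (ℓ : E → ℝ) (ω : ℝ) :
    secA ι τ ∅ ℓ (-ω) =
      Matrix.diagonal (Sum.elim (fun _ => -1) fun p => if p.2 then -1 else 1) *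
        secA ι τ ∅ ℓ ω * Matrix.diagonal (Sum.elim (fun _ => 1) fun _ => -1) := by
  ext i j
  rw [Matrix.mul_diagonal, Matrix.diagonal_mul]
  rcases i with v | ⟨e, b⟩ <;> rcases j with u | ⟨f, b'⟩
  · simp [secA, secMatrix]
  · cases b' <;> simp [secA, secMatrix] <;> split_ifs <;> simp
  · cases b <;> simp [secA, secMatrix]
  · cases b <;> cases b' <;> simp [secA, secMatrix] <;> split_ifs <;> simp

/-- For a graph with `|V| = |E| + 1`, the secular determinant is an odd function of `ω`. -/
lemma det_secA_neg {V E : Type} [Fintype V] [Fintype E] (ι τ : E → V)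
    (htree : Fintype.card E + 1 = Fintype.card V) (ℓ : E → ℝ) (ω : ℝ) :
    (secA ι τ ∅ ℓ (-ω)).det = -(secA ι τ ∅ ℓ ω).det := by
  rw [secA_neg, Matrix.det_mul, Matrix.det_mul, Matrix.det_diagonal, Matrix.det_diagonal]
  simp [Fintype.prod_sum_type, Fintype.prod_prod_type, ← htree, pow_succ, pow_mul, ← mul_pow]

/-- Simultaneous recurrence: a linear flow on a torus returns arbitrarily close to its
starting point at arbitrarily late times. -/
lemma exists_recurrence_seq {E : Type} [Fintype E] (ℓ : E → ℝ) :
    ∃ T : ℕ → ℝ, Tendsto T atTop atTop ∧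
      ∀ e, Tendsto (fun n => Complex.exp (Complex.I * (ℓ e * T n : ℝ))) atTop (𝓝 1) := by
  let z : ℕ → E → ℂ := fun n e => Complex.exp (Complex.I * (ℓ e * n : ℝ))
  have hz : ∀ n, z n ∈ Set.univ.pi fun _ : E => Metric.sphere (0 : ℂ) 1 := fun n e _ => by
    simp only [z, mem_sphere_zero_iff_norm, Complex.norm_exp_I_mul_ofReal]
  obtain ⟨a, ha, φ, hφ, hlim⟩ :=
    (isCompact_univ_pi fun _ : E => isCompact_sphere (0 : ℂ) 1).tendsto_subseq hz
  have hgap : ∀ n, n + φ n ≤ φ (2 * n) := fun n => by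
    have := hφ.add_le_nat n n
    rwa [← two_mul] at this
  refine ⟨fun n => φ (2 * n) - φ n, tendsto_atTop_mono (fun n => ?_)
    tendsto_natCast_atTop_atTop, fun e => ?_⟩
  · have : ((n + φ n : ℕ) : ℝ) ≤ φ (2 * n) := by exact_mod_cast hgap n
    push_cast at this
    linarith
  · have hae : a e ≠ 0 := ne_zero_of_mem_unit_sphere (⟨a e, ha e trivial⟩ : Metric.sphere (0 : ℂ) 1)
    have h₁ : Tendsto (fun n => z (φ n) e) atTop (𝓝 (a e)) := tendsto_pi_nhds.1 hlim e
    have h₂ : Tendsto (fun n => z (φ (2 * n)) e) atTop (𝓝 (a e)) :=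
      h₁.comp (tendsto_id.const_mul_atTop' two_pos)
    have h₃ := h₂.div h₁ hae
    rw [div_self hae] at h₃
    refine h₃.congr fun n => ?_
    simp only [Pi.div_apply, z, ← Complex.exp_sub]
    congr 1
    push_cast
    ring

lemma tendsto_cos_sin_of_tendsto_exp {T : ℕ → ℝ}
    (h : Tendsto (fun n => Complex.exp (Complex.I * (T n : ℝ))) atTop (𝓝 1)) :
    Tendsto (fun n => Real.cos (T n)) atTop (𝓝 1) ∧
      Tendsto (fun n => Real.sin (T n)) atTop (𝓝 0) := by
  constructor
  · have := (Complex.continuous_re.tendsto _).comp h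
    simpa [Function.comp_def, mul_comm Complex.I, Complex.exp_ofReal_mul_I_re] using this
  · have := (Complex.continuous_im.tendsto _).comp h
    simpa [Function.comp_def, mul_comm Complex.I, Complex.exp_ofReal_mul_I_im] using this

/-- Along a recurrence sequence, `A_{T_n + t}` converges to `A_t`. -/
lemma tendsto_secA_add {V E : Type} (ι τ : E → V) (VD : Set V) (ℓ : E → ℝ) {T : ℕ → ℝ}
    (h : ∀ e, Tendsto (fun n => Complex.exp (Complex.I * (ℓ e * T n : ℝ))) atTop (𝓝 1))
    (t : ℝ) : Tendsto (fun n => secA ι τ VD ℓ (T n + t)) atTop (𝓝 (secA ι τ VD ℓ t)) := by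
  have hc := fun e => (tendsto_cos_sin_of_tendsto_exp (h e)).1
  have hs := fun e => (tendsto_cos_sin_of_tendsto_exp (h e)).2
  have hcs : Tendsto
      (fun n => (fun e => Real.cos (ℓ e * (T n + t)), fun e => Real.sin (ℓ e * (T n + t))))
      atTop (𝓝 (fun e => Real.cos (ℓ e * t), fun e => Real.sin (ℓ e * t))) := by
    refine Tendsto.prodMk_nhds (tendsto_pi_nhds.2 fun e => ?_) (tendsto_pi_nhds.2 fun e => ?_)
    · simpa [mul_add, Real.cos_add] using
        ((hc e).mul_const (Real.cos (ℓ e * t))).sub ((hs e).mul_const (Real.sin (ℓ e * t)))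
    · simpa [mul_add, Real.sin_add] using
        ((hs e).mul_const (Real.cos (ℓ e * t))).add ((hc e).mul_const (Real.sin (ℓ e * t)))
  exact ((continuous_secMatrix ι τ VD).tendsto _).comp hcs

/-- Near late recurrence times, an odd secular determinant has a zero. -/
lemma eventually_exists_det_secA_eq_zero {V E : Type} [Fintype V] [Fintype E] (ι τ : E → V)
    (htree : Fintype.card E + 1 = Fintype.card V) (ℓ : E → ℝ) {T : ℕ → ℝ}
    (h : ∀ e, Tendsto (fun n => Complex.exp (Complex.I * (ℓ e * T n : ℝ))) atTop (𝓝 1))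
    {ε : ℝ} (hε : 0 < ε) :
    ∀ᶠ n in atTop, ∃ s, |s| ≤ ε ∧ (secA ι τ ∅ ℓ (T n + s)).det = 0 := by
  let g : ℝ → ℝ := fun ω => (secA ι τ ∅ ℓ ω).det
  have hg : AnalyticOnNhd ℝ g Set.univ := fun t _ => analyticAt_det_secA ι τ ∅ ℓ t
  have hcont : Continuous g := continuous_iff_continuousAt.2 fun t => (hg t trivial).continuousAt
  have hlim : ∀ t, Tendsto (fun n => g (T n + t)) atTop (𝓝 (g t)) := fun t =>
    (continuous_id.matrix_det.tendsto _).comp (tendsto_secA_add ι τ ∅ ℓ h t)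
  rcases (hg 0 trivial).eventually_eq_zero_or_eventually_ne_zero with h0 | h0
  · have hzero : g = 0 := hg.eq_of_eventuallyEq analyticOnNhd_const h0
    exact Eventually.of_forall fun n => ⟨0, by simpa using hε.le, congrFun hzero _⟩
  · obtain ⟨δ, hδ, hδ0, hδε⟩ : ∃ δ, g δ ≠ 0 ∧ 0 < δ ∧ δ < ε :=
      ((h0.filter_mono (nhdsGT_le_nhdsNE 0)).and (Ioo_mem_nhdsGT hε)).exists
    have hneg : g (-δ) = -g δ := det_secA_neg ι τ htree ℓ δ
    have hprod : ∀ᶠ n in atTop, g (T n + -δ) * g (T n + δ) < 0 := by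
      refine ((hlim (-δ)).mul (hlim δ)).eventually_lt_const ?_
      rw [hneg, neg_mul]
      exact neg_neg_of_pos (mul_self_pos.2 hδ)
    filter_upwards [hprod] with n hn
    have hmem : (0 : ℝ) ∈ Set.uIcc (g (T n + -δ)) (g (T n + δ)) := by
      rcases mul_neg_iff.1 hn with ⟨h₁, h₂⟩ | ⟨h₁, h₂⟩
      · exact Set.mem_uIcc.2 (Or.inr ⟨h₂.le, h₁.le⟩)
      · exact Set.mem_uIcc.2 (Or.inl ⟨h₁.le, h₂.le⟩)
    obtain ⟨s, hs, hs0⟩ := intermediate_value_uIcc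
      (f := fun s => g (T n + s)) (a := -δ) (b := δ) (by fun_prop) hmem
    rw [Set.uIcc_of_le (by linarith)] at hs
    exact ⟨s, (abs_le.2 hs).trans hδε.le, hs0⟩

/-- On a metric tree with standard conditions, there is a sequence of positive
eigenfrequencies `ω_n → ∞` with `det A_{ω_n}(G) = 0` and
`‖A_{ω_n}(G) - A₀(G)‖_F → 0`. -/
theorem exists_zero_sequence_tending_to_A_zero {V E : Type} [Fintype V] [Fintype E]
    (ι τ : E → V) (hnl : ∀ e, ι e ≠ τ e)
    (hconn : IsConnectedGraph ι τ)
    (htree : Fintype.card E + 1 = Fintype.card V)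
    (ℓ : E → ℝ) (hℓ : ∀ e, 0 < ℓ e) :
    ∃ ω : ℕ → ℝ, (∀ n, 0 < ω n) ∧
      Tendsto ω atTop atTop ∧
      (∀ n, (secA ι τ (∅ : Set V) ℓ (ω n)).det = 0) ∧
      Tendsto (fun n => frobNorm (secA ι τ (∅ : Set V) ℓ (ω n) - secA ι τ (∅ : Set V) ℓ 0))
        atTop (nhds 0) := by
  obtain ⟨T, hT, hexp⟩ := exists_recurrence_seq ℓ
  have key : ∀ k : ℕ, ∃ n s, (k : ℝ) + 2 ≤ T n ∧ |s| ≤ 1 / ((k : ℝ) + 1) ∧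
      (secA ι τ ∅ ℓ (T n + s)).det = 0 ∧ k ≤ n := fun k => by
    obtain ⟨n, h₁, ⟨s, h₂, h₃⟩, h₄⟩ := ((hT.eventually_ge_atTop ((k : ℝ) + 2)).and
      ((eventually_exists_det_secA_eq_zero ι τ htree ℓ hexp
        (Nat.one_div_pos_of_nat (α := ℝ) (n := k))).and (eventually_ge_atTop k))).exists
    exact ⟨n, s, h₁, h₂, h₃, h₄⟩
  choose n s hTn hs hdet hn using key
  have hs1 : ∀ k, -1 ≤ s k := fun k => by
    have h₁ : 1 / ((k : ℝ) + 1) ≤ 1 := by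
      rw [div_le_one (by positivity)]
      linarith [k.cast_nonneg (α := ℝ)]
    linarith [neg_abs_le (s k), hs k]
  have hlower : ∀ k : ℕ, (k : ℝ) + 1 ≤ T (n k) + s k := fun k => by
    linarith [hTn k, hs1 k]
  have hs0 : Tendsto s atTop (𝓝 0) :=
    squeeze_zero_norm hs tendsto_one_div_add_atTop_nhds_zero_nat
  have hn' : Tendsto n atTop atTop := tendsto_atTop_mono hn tendsto_id
  refine ⟨fun k => T (n k) + s k, fun k => by linarith [hlower k, k.cast_nonneg (α := ℝ)],
    tendsto_atTop_mono (fun k => (le_add_of_nonneg_right zero_le_one).trans (hlower k))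
      tendsto_natCast_atTop_atTop, hdet, ?_⟩
  have hlim : Tendsto (fun k => secA ι τ ∅ ℓ (T (n k) + s k)) atTop (𝓝 (secA ι τ ∅ ℓ 0)) := by
    have hexp' : ∀ e, Tendsto
        (fun k => Complex.exp (Complex.I * (ℓ e * (T (n k) + s k) : ℝ))) atTop (𝓝 1) := fun e => by
      have hcont : Continuous fun t : ℝ => Complex.exp (Complex.I * (ℓ e * t : ℝ)) := by fun_prop
      have := ((hexp e).comp hn').mul ((hcont.tendsto 0).comp hs0)
      simpa [Function.comp_def, mul_add, Complex.exp_add] using this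
    simpa using tendsto_secA_add ι τ ∅ ℓ hexp' 0
  have := (continuous_frobNorm.tendsto _).comp (hlim.sub_const (secA ι τ ∅ ℓ 0))
  simpa [Function.comp_def, frobNorm] using this
end

section
/- Let G be a connected graph with edge lengths ℓ and let V_D ⊆ V be nonempty with every vertex in V_D of degree one. Suppose ω₀ > 0 satisfies det A_{ω₀}(G, V_D) = 0 and det A_ω(G, V_D) ≠ 0 for all 0 < ω < ω₀ (so that ω₀ is the smallest positive zero of the secular function, corresponding to the ground state eigenvalue ω₀² of the Laplacian). Then the function ω ↦ det A_ω(G, V_D) changes sign in every neighbourhood of ω₀: for every ε > 0 there exist ω₁, ω₂ ∈ (ω₀ − ε, ω₀ + ε) with det A_{ω₁}(G, V_D) · det A_{ω₂}(G, V_D) < 0. -/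
open Matrix Filter Topology

attribute [local instance] Classical.propDecidable

noncomputable section

/-- The symmetric matrix of the quadratic form
`z ↦ ∑ e, (c e * ((a e ⬝ᵥ z) ^ 2 + (b e ⬝ᵥ z) ^ 2) - 2 * k e * (a e ⬝ᵥ z) * (b e ⬝ᵥ z))`. -/
def edgeFormMatrix {W E : Type} [Fintype E] (a b : E → W → ℝ) (c k : E → ℝ) : Matrix W W ℝ :=
  Matrix.of fun w u => ∑ e, (c e * (a e w * a e u + b e w * b e u) -
    k e * (a e w * b e u + b e w * a e u))

theorem dotProduct_edgeFormMatrix_mulVec {W E : Type} [Fintype W] [Fintype E]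
    (a b : E → W → ℝ) (c k : E → ℝ) (x y : W → ℝ) :
    x ⬝ᵥ edgeFormMatrix a b c k *ᵥ y =
      ∑ e, (c e * ((a e ⬝ᵥ x) * (a e ⬝ᵥ y) + (b e ⬝ᵥ x) * (b e ⬝ᵥ y)) -
        k e * ((a e ⬝ᵥ x) * (b e ⬝ᵥ y) + (b e ⬝ᵥ x) * (a e ⬝ᵥ y))) := by
  have h : edgeFormMatrix a b c k = ∑ e, (c e • (vecMulVec (a e) (a e) + vecMulVec (b e) (b e)) -
      k e • (vecMulVec (a e) (b e) + vecMulVec (b e) (a e))) := by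
    ext w u
    simp [edgeFormMatrix, Matrix.sum_apply, vecMulVec_apply, mul_add]
  rw [h, Matrix.sum_mulVec, dotProduct_sum]
  refine Finset.sum_congr rfl fun e _ => ?_
  simp only [sub_mulVec, smul_mulVec, add_mulVec, vecMulVec_mulVec, op_smul_eq_smul,
    dotProduct_comm x, sub_dotProduct, add_dotProduct, smul_dotProduct, smul_eq_mul]
  ring

/-- The indicator of the vertex `v`, restricted to the non-Dirichlet vertices. -/
def freeIndicator {V : Type} (VD : Set V) (v : V) : {v // v ∉ VD} → ℝ :=
  fun w => if v = w then 1 else 0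

/-- The matrix on the non-Dirichlet vertices assembled from the edge blocks
`!![c e, -k e; -k e, c e]`; it is the discrete Dirichlet-to-Neumann map. -/
def dnMatrix {V E : Type} [Fintype E] (ι τ : E → V) (VD : Set V) (c k : E → ℝ) :
    Matrix {v // v ∉ VD} {v // v ∉ VD} ℝ :=
  edgeFormMatrix (fun e => freeIndicator VD (ι e)) (fun e => freeIndicator VD (τ e)) c k

theorem det_secMatrix {V E : Type} [Fintype V] [Fintype E] (ι τ : E → V) (VD : Set V)
    (c s : E → ℝ) (hs : ∀ e, s e ≠ 0) (hcs : ∀ e, c e ^ 2 + s e ^ 2 = 1) :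
    (secMatrix ι τ VD c s).det =
      (∏ e, s e) * (dnMatrix ι τ VD (fun e => c e / s e) (fun e => (s e)⁻¹)).det := by
  set A := secMatrix ι τ VD c s with hA
  let Y : Matrix (E × Bool) V ℝ := Matrix.of fun p u =>
    if p.2 then ((if u = τ p.1 then c p.1 else 0) - (if u = ι p.1 then 1 else 0)) / s p.1
    else ((if u = ι p.1 then c p.1 else 0) - (if u = τ p.1 then 1 else 0)) / s p.1
  have hcancel : A.toBlocks₂₁ + A.toBlocks₂₂ * Y = 0 := by
    ext ⟨e, b⟩ u
    have := hs e
    have := hcs e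
    cases b
    · simp [hA, secMatrix, toBlocks₂₁, toBlocks₂₂, Matrix.mul_apply, Fintype.sum_prod_type, Y]
      split_ifs <;> field_simp <;> ring
    · simp [hA, secMatrix, toBlocks₂₁, toBlocks₂₂, Matrix.mul_apply, Fintype.sum_prod_type, Y,
        Finset.sum_add_distrib]
      split_ifs <;> field_simp <;> grind
  have hfactor : A * fromBlocks 1 0 Y 1 =
      fromBlocks (A.toBlocks₁₁ + A.toBlocks₁₂ * Y) A.toBlocks₁₂ 0 A.toBlocks₂₂ := by
    conv_lhs => rw [← fromBlocks_toBlocks A]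
    rw [fromBlocks_multiply]
    simp [hcancel]
  have hdet : A.det = (A.toBlocks₁₁ + A.toBlocks₁₂ * Y).det * A.toBlocks₂₂.det := by
    have := congrArg Matrix.det hfactor
    rwa [det_mul, det_fromBlocks_zero₁₂, det_fromBlocks_zero₂₁, det_one, det_one, mul_one,
      mul_one] at this
  have hedge : A.toBlocks₂₂.det = ∏ e, s e := by
    have : A.toBlocks₂₂ = reindex (Equiv.prodComm Bool E) (Equiv.prodComm Bool E)
        (blockDiagonal fun e => !![s e, 0; c e, 1].submatrix finTwoEquiv.symm finTwoEquiv.symm) := by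
      ext ⟨e, b⟩ ⟨f, b'⟩
      by_cases h : e = f <;> cases b <;> cases b' <;>
        simp [hA, secMatrix, toBlocks₂₂, blockDiagonal_apply, finTwoEquiv, h, eq_comm (a := f)]
    rw [this, det_reindex_self, det_blockDiagonal]
    refine Finset.prod_congr rfl fun e _ => ?_
    rw [det_submatrix_equiv_self, det_fin_two]
    simp
  have hvert : (A.toBlocks₁₁ + A.toBlocks₁₂ * Y).det =
      (dnMatrix ι τ VD (fun e => c e / s e) (fun e => (s e)⁻¹)).det := by
    rw [twoBlockTriangular_det _ (fun v => v ∉ VD)]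
    · have h1 : toSquareBlockProp (A.toBlocks₁₁ + A.toBlocks₁₂ * Y) (fun v => ¬ v ∉ VD) = 1 := by
        ext ⟨v, hv⟩ ⟨u, hu⟩
        simp only [not_not] at hv hu
        simp [toSquareBlockProp, hA, secMatrix, toBlocks₁₁, toBlocks₁₂, Matrix.mul_apply,
          hv, Matrix.one_apply, eq_comm (a := u)]
      have h2 : toSquareBlockProp (A.toBlocks₁₁ + A.toBlocks₁₂ * Y) (fun v => v ∉ VD) =
          dnMatrix ι τ VD (fun e => c e / s e) (fun e => (s e)⁻¹) := by
        ext ⟨v, hv⟩ ⟨u, hu⟩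
        simp [toSquareBlockProp, hA, secMatrix, toBlocks₁₁, toBlocks₁₂, Matrix.mul_apply,
          hv, dnMatrix, edgeFormMatrix, freeIndicator, Fintype.sum_prod_type, Y,
          -Finset.sum_sub_distrib]
        refine Finset.sum_congr rfl fun e _ => ?_
        simp only [eq_comm (a := u)]
        split_ifs <;> ring
      rw [h1, h2, det_one, mul_one]
    · intro i hi j hj
      simp only [not_not] at hi
      have : j ≠ i := by rintro rfl; exact hj hi
      simp [hA, secMatrix, toBlocks₁₁, toBlocks₁₂, Matrix.mul_apply, hi, this]
  rw [hdet, hedge, hvert, mul_comm]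

theorem dotProduct_mulVec_pos_of_det_ne_zero {n : Type} [Fintype n] [DecidableEq n]
    {M : ℝ → Matrix n n ℝ} {T : ℝ} (hT : 0 ≤ T) (hcont : ContinuousOn M (Set.Icc 0 T))
    (hsymm : ∀ t, (M t).IsSymm) (h0 : ∀ z, z ≠ 0 → 0 < z ⬝ᵥ M 0 *ᵥ z)
    (hdet : ∀ t ∈ Set.Icc 0 T, (M t).det ≠ 0) {z : n → ℝ} (hz : z ≠ 0) :
    0 < z ⬝ᵥ M T *ᵥ z := by
  by_contra! hneg
  let K : Set (n → ℝ) := Metric.sphere 0 1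
  have hK : IsCompact K := isCompact_sphere 0 1
  have hnormalize : ∀ y : n → ℝ, y ≠ 0 → ‖y‖⁻¹ • y ∈ K := fun y hy => by
    simp [K, norm_smul, hy]
  have hscale : ∀ (t : ℝ) (y : n → ℝ), (‖y‖⁻¹ • y) ⬝ᵥ M t *ᵥ (‖y‖⁻¹ • y) =
      ‖y‖⁻¹ ^ 2 * (y ⬝ᵥ M t *ᵥ y) := fun t y => by
    rw [mulVec_smul, dotProduct_smul, smul_dotProduct]
    simp only [smul_eq_mul]
    ring
  have hne : K.Nonempty := ⟨_, hnormalize z hz⟩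
  let q : Set.Icc (0 : ℝ) T → (n → ℝ) → ℝ := fun t y => y ⬝ᵥ M t *ᵥ y
  have hMc : Continuous fun t : Set.Icc (0 : ℝ) T => M t := hcont.domRestrict
  have hq : Continuous ↿q := by
    have h1 : Continuous fun p : Set.Icc (0 : ℝ) T × (n → ℝ) => M p.1 := hMc.comp continuous_fst
    exact continuous_snd.dotProduct (h1.matrix_mulVec continuous_snd)
  have hqt : ∀ t, ContinuousOn (q t) K := fun t =>
    (hq.comp (Continuous.prodMk_right t)).continuousOn
  have hφ : Continuous fun t => sInf (q t '' K) := hK.continuous_sInf hq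
  have hle : ∀ t, ∀ y ∈ K, sInf (q t '' K) ≤ q t y := fun t y hy =>
    csInf_le (hK.image_of_continuousOn (hqt t)).bddBelow ⟨y, hy, rfl⟩
  have : PreconnectedSpace (Set.Icc (0 : ℝ) T) :=
    isPreconnected_iff_preconnectedSpace.1 isPreconnected_Icc
  have hleft : 0 ≤ sInf (q ⟨0, le_rfl, hT⟩ '' K) := by
    refine le_csInf (hne.image _) ?_
    rintro _ ⟨y, hy, rfl⟩
    exact (h0 y (by rintro rfl; simp [K] at hy)).le
  have hright : sInf (q ⟨T, hT, le_rfl⟩ '' K) ≤ 0 := by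
    refine (hle _ _ (hnormalize z hz)).trans ?_
    change (‖z‖⁻¹ • z) ⬝ᵥ M T *ᵥ (‖z‖⁻¹ • z) ≤ 0
    rw [hscale]
    exact mul_nonpos_of_nonneg_of_nonpos (by positivity) hneg
  obtain ⟨t, ht⟩ := intermediate_value_univ _ _ hφ ⟨hright, hleft⟩
  obtain ⟨y, hyK, hy⟩ := hK.exists_sInf_image_eq hne (hqt t)
  have hpsd : (M t).PosSemidef := by
    refine PosSemidef.of_dotProduct_mulVec_nonneg ?_ fun x => ?_
    · simpa [IsHermitian, IsSymm] using hsymm t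
    · rw [star_trivial]
      by_cases hx : x = 0
      · simp [hx]
      · have h1 := hle t _ (hnormalize x hx)
        simp only at ht
        rw [ht] at h1
        change 0 ≤ (‖x‖⁻¹ • x) ⬝ᵥ M t *ᵥ (‖x‖⁻¹ • x) at h1
        rw [hscale] at h1
        have : 0 < ‖x‖⁻¹ ^ 2 := by positivity
        exact nonneg_of_mul_nonneg_right h1 this
  have hker : M t *ᵥ y = 0 := by
    rw [← hpsd.dotProduct_mulVec_zero_iff, star_trivial]
    exact hy.symm.trans ht
  exact hdet t t.2 (exists_mulVec_eq_zero_iff.1 ⟨y, by rintro rfl; simp [K] at hyK, hker⟩)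

theorem exists_mul_neg_of_hasDerivAt {f : ℝ → ℝ} {f' x : ℝ} (hf : HasDerivAt f f' x)
    (hx : f x = 0) (hf' : f' ≠ 0) {ε : ℝ} (hε : 0 < ε) :
    ∃ a ∈ Set.Ioo (x - ε) x, ∃ b ∈ Set.Ioo x (x + ε), f a * f b < 0 := by
  have hslope : ∀ᶠ y in 𝓝[≠] x, 0 < slope f x y * f' :=
    ((hasDerivAt_iff_tendsto_slope.1 hf).mul_const f').eventually
      (lt_mem_nhds (mul_self_pos.2 hf'))
  have hl := hslope.filter_mono (nhdsWithin_mono x (s := Set.Iio x) fun y hy => ne_of_lt hy)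
  have hr := hslope.filter_mono (nhdsWithin_mono x (s := Set.Ioi x) fun y hy => ne_of_gt hy)
  obtain ⟨a, ha, ha1, ha2⟩ :=
    (hl.and (Ioo_mem_nhdsLT (show x - ε < x by linarith))).exists
  obtain ⟨b, hb, hb1, hb2⟩ :=
    (hr.and (Ioo_mem_nhdsGT (show x < x + ε by linarith))).exists
  refine ⟨a, ⟨ha1, ha2⟩, b, ⟨hb1, hb2⟩, ?_⟩
  have hfa : f a = slope f x a * (a - x) := by
    rw [slope_def_field, hx]; field_simp [sub_ne_zero.2 ha2.ne]; ring
  have hfb : f b = slope f x b * (b - x) := by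
    rw [slope_def_field, hx]; field_simp [sub_ne_zero.2 hb1.ne']; ring
  have hs : 0 < slope f x a * slope f x b := by
    have := mul_pos ha hb
    have h2 : 0 < f' ^ 2 := by positivity
    have h3 : 0 < (slope f x a * slope f x b) * f' ^ 2 := by linarith
    exact pos_of_mul_pos_left h3 h2.le
  have h4 : 0 < (x - a) * (b - x) := mul_pos (by linarith) (by linarith)
  rw [hfa, hfb]
  nlinarith [mul_pos hs h4]

theorem HasDerivAt.mul_of_continuousAt_of_eq_zero {f g : ℝ → ℝ} {f' x : ℝ}
    (hf : HasDerivAt f f' x) (hx : f x = 0) (hg : ContinuousAt g x) :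
    HasDerivAt (fun t => f t * g t) (f' * g x) x := by
  rw [hasDerivAt_iff_tendsto_slope] at hf ⊢
  refine (hf.mul (hg.tendsto.mono_left nhdsWithin_le_nhds)).congr fun t => ?_
  simp only [slope_def_field, hx]
  ring

theorem hasDerivAt_det_mul_adjugate {n : Type} [Fintype n] [DecidableEq n]
    {M : ℝ → Matrix n n ℝ} {M' : Matrix n n ℝ} {x : ℝ}
    (hM : ∀ i j, HasDerivAt (fun t => M t i j) (M' i j) x) (hsymm : ∀ t, (M t).IsSymm)
    (hdet : (M x).det = 0) (j : n) :
    HasDerivAt (fun t => (M t).det * (M x).adjugate j j)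
      ((fun i => (M x).adjugate i j) ⬝ᵥ M' *ᵥ fun i => (M x).adjugate i j) x := by
  set p : n → ℝ := fun i => (M x).adjugate i j with hp
  have hadj : ∀ t, M t *ᵥ (fun i => (M t).adjugate i j) = (M t).det • Pi.single j 1 := fun t => by
    ext i
    have := congrFun (congrFun (mul_adjugate (M t)) i) j
    simpa [Matrix.mul_apply, mulVec, dotProduct, Matrix.one_apply, Pi.single_apply] using this
  have hker : M x *ᵥ p = 0 := by rw [hp, hadj, hdet, zero_smul]
  have hexpand : ∀ t, (M t).det * p j = ∑ i, (M t *ᵥ p) i * (M t).adjugate i j := fun t => by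
    have h1 : (M t *ᵥ p) ⬝ᵥ (fun i => (M t).adjugate i j) = p ⬝ᵥ (M t).det • Pi.single j 1 := by
      rw [← hadj, dotProduct_mulVec, ← mulVec_transpose, (hsymm t).eq]
    rw [dotProduct_smul, dotProduct_single, mul_one, smul_eq_mul] at h1
    exact h1.symm
  have hcont : ContinuousAt M x :=
    continuousAt_pi.2 fun i => continuousAt_pi.2 fun j => (hM i j).continuousAt
  have hadjc : ContinuousAt (fun t => (M t).adjugate) x :=
    (continuous_id.matrix_adjugate).continuousAt.comp hcont
  have hderiv : HasDerivAt (fun t => ∑ i, (M t *ᵥ p) i * (M t).adjugate i j)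
      (∑ i, (M' *ᵥ p) i * (M x).adjugate i j) x := by
    refine HasDerivAt.fun_sum fun i _ => ?_
    refine HasDerivAt.mul_of_continuousAt_of_eq_zero ?_ (congrFun hker i) ?_
    · simp only [mulVec, dotProduct]
      exact HasDerivAt.fun_sum fun k _ => (hM i k).mul_const _
    · exact (continuousAt_pi.1 (continuousAt_pi.1 hadjc i)) j
  rw [dotProduct_comm]
  exact hderiv.congr_of_eventuallyEq (Eventually.of_forall hexpand)

theorem adjugate_diag_ne_zero {n : Type} [Fintype n] [DecidableEq n] {A : Matrix n n ℝ}
    (hA : A.PosSemidef) (i : n) (h : ∀ z, A *ᵥ z = 0 → z i = 0 → z = 0) :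
    A.adjugate i i ≠ 0 := by
  rw [adjugate_apply]
  intro hdet
  obtain ⟨z, hz, hzero⟩ := exists_mulVec_eq_zero_iff.2 hdet
  have hi : z i = 0 := by
    have := congrFun hzero i
    simpa [mulVec, updateRow_self] using this
  refine hz (h z ?_ hi)
  rw [← hA.dotProduct_mulVec_zero_iff, star_trivial]
  refine Finset.sum_eq_zero fun k _ => ?_
  by_cases hk : k = i
  · rw [hk, hi, zero_mul]
  · have := congrFun hzero k
    rw [mulVec, updateRow_ne hk] at this
    change A k ⬝ᵥ z = 0 at this
    change z k * (A k ⬝ᵥ z) = 0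
    rw [this, mul_zero]

/-- Extension by zero of a function on the non-Dirichlet vertices. -/
def zeroExtend {V : Type} [Fintype V] (VD : Set V) (z : {v // v ∉ VD} → ℝ) (v : V) : ℝ :=
  freeIndicator VD v ⬝ᵥ z

section zeroExtend

variable {V : Type} [Fintype V] {VD : Set V}

theorem zeroExtend_of_mem (z : {v // v ∉ VD} → ℝ) {v : V} (hv : v ∈ VD) :
    zeroExtend VD z v = 0 := by
  refine Finset.sum_eq_zero fun w _ => ?_
  have : v ≠ w := by rintro rfl; exact w.2 hv
  simp [freeIndicator, this]

theorem zeroExtend_coe (z : {v // v ∉ VD} → ℝ) (w : {v // v ∉ VD}) :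
    zeroExtend VD z w = z w := by
  simp [zeroExtend, freeIndicator, dotProduct, ← Subtype.ext_iff]

theorem zeroExtend_abs (z : {v // v ∉ VD} → ℝ) (v : V) :
    zeroExtend VD (fun w => |z w|) v = |zeroExtend VD z v| := by
  by_cases hv : v ∈ VD
  · simp [zeroExtend_of_mem _ hv]
  · rw [zeroExtend_coe _ ⟨v, hv⟩, zeroExtend_coe _ ⟨v, hv⟩]

theorem zeroExtend_single (w : {v // v ∉ VD}) (v : V) :
    zeroExtend VD (Pi.single w 1) v = if v = w then 1 else 0 := by
  simp [zeroExtend, freeIndicator]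

theorem exists_zeroExtend_ne_zero {E : Type} {ι τ : E → V} (hconn : IsConnectedGraph ι τ)
    (hVD : VD.Nonempty) {z : {v // v ∉ VD} → ℝ} (hz : z ≠ 0) :
    ∃ e, zeroExtend VD z (ι e) ≠ 0 ∨ zeroExtend VD z (τ e) ≠ 0 := by
  obtain ⟨w, hw⟩ := Function.ne_iff.1 hz
  obtain ⟨d, hd⟩ := hVD
  rcases Relation.ReflTransGen.cases_head (hconn w d) with h | ⟨u, ⟨e, he⟩, -⟩
  · exact absurd (h ▸ hd) w.2
  · refine ⟨e, ?_⟩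
    rw [← zeroExtend_coe z w] at hw
    rcases he with ⟨h, -⟩ | ⟨-, h⟩
    · exact Or.inl (h ▸ hw)
    · exact Or.inr (h ▸ hw)

end zeroExtend

theorem GraphAdj.symm {V E : Type} {ι τ : E → V} {u w : V} (h : GraphAdj ι τ u w) :
    GraphAdj ι τ w u := by
  obtain ⟨e, he⟩ := h
  exact ⟨e, he.symm⟩

section graphDegree

variable {V E : Type} [Fintype E] {ι τ : E → V}

theorem eq_of_graphDegree_eq_one {v : V} (h : graphDegree ι τ v = 1) {e f : E}
    (he : ι e = v ∨ τ e = v) (hf : ι f = v ∨ τ f = v) : e = f := by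
  rw [graphDegree, Finset.card_eq_one] at h
  obtain ⟨g, hg⟩ := h
  have h1 : e ∈ ({g} : Finset E) := hg ▸ by simpa using he
  have h2 : f ∈ ({g} : Finset E) := hg ▸ by simpa using hf
  rw [Finset.mem_singleton] at h1 h2
  rw [h1, h2]

theorem eq_of_graphAdj_of_graphDegree_eq_one (hnl : ∀ e, ι e ≠ τ e) {v u w : V}
    (h : graphDegree ι τ v = 1) (hu : GraphAdj ι τ v u) (hw : GraphAdj ι τ v w) : u = w := by
  obtain ⟨e, he⟩ := hu
  obtain ⟨f, hf⟩ := hw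
  obtain rfl : e = f := eq_of_graphDegree_eq_one h (he.imp And.left And.right)
    (hf.imp And.left And.right)
  have := hnl e
  grind

theorem eq_endpoint_of_mem_dirichlet {VD : Set V} (hnl : ∀ e, ι e ≠ τ e)
    (hconn : IsConnectedGraph ι τ)
    (hdeg : ∀ v ∈ VD, graphDegree ι τ v = 1) {e : E} (hι : ι e ∈ VD) (hτ : τ e ∈ VD) (v : V) :
    v = ι e ∨ v = τ e := by
  induction hconn (ι e) v with
  | refl => exact Or.inl rfl
  | tail _ hadj ih =>
    rcases ih with rfl | rfl
    · exact Or.inr (eq_of_graphAdj_of_graphDegree_eq_one hnl (hdeg _ hι) hadj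
        ⟨e, Or.inl ⟨rfl, rfl⟩⟩)
    · exact Or.inl (eq_of_graphAdj_of_graphDegree_eq_one hnl (hdeg _ hτ) hadj
        ⟨e, Or.inr ⟨rfl, rfl⟩⟩)

end graphDegree

section dnMatrixEntries

variable {V E : Type} [Fintype E] {ι τ : E → V} {VD : Set V}

theorem dnMatrix_isSymm (c k : E → ℝ) : (dnMatrix ι τ VD c k).IsSymm := by
  ext w u
  simp only [transpose_apply, dnMatrix, edgeFormMatrix, of_apply]
  refine Finset.sum_congr rfl fun e _ => ?_
  ring

theorem dnMatrix_smul (r : ℝ) (c k : E → ℝ) :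
    dnMatrix ι τ VD (r • c) (r • k) = r • dnMatrix ι τ VD c k := by
  ext w u
  simp only [Matrix.smul_apply, dnMatrix, edgeFormMatrix, of_apply, Pi.smul_apply, smul_eq_mul,
    Finset.mul_sum]
  refine Finset.sum_congr rfl fun e _ => ?_
  ring

theorem hasDerivAt_dnMatrix_apply {c k : ℝ → E → ℝ} {c' k' : E → ℝ} {x : ℝ}
    (hc : ∀ e, HasDerivAt (fun t => c t e) (c' e) x)
    (hk : ∀ e, HasDerivAt (fun t => k t e) (k' e) x) (i j : {v // v ∉ VD}) :
    HasDerivAt (fun t => dnMatrix ι τ VD (c t) (k t) i j) (dnMatrix ι τ VD c' k' i j) x :=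
  HasDerivAt.fun_sum fun e _ => ((hc e).mul_const _).sub ((hk e).mul_const _)

theorem continuousOn_dnMatrix {c k : ℝ → E → ℝ} {s : Set ℝ}
    (hc : ∀ e, ContinuousOn (fun t => c t e) s) (hk : ∀ e, ContinuousOn (fun t => k t e) s) :
    ContinuousOn (fun t => dnMatrix ι τ VD (c t) (k t)) s :=
  continuousOn_pi.2 fun _ => continuousOn_pi.2 fun _ => continuousOn_finsetSum _ fun e _ =>
    ((hc e).mul continuousOn_const).sub ((hk e).mul continuousOn_const)

end dnMatrixEntries

section dnMatrix

variable {V E : Type} [Fintype V] [Fintype E] {ι τ : E → V} {VD : Set V}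

theorem dotProduct_dnMatrix_mulVec (c k : E → ℝ) (x y : {v // v ∉ VD} → ℝ) :
    x ⬝ᵥ dnMatrix ι τ VD c k *ᵥ y =
      ∑ e, (c e * (zeroExtend VD x (ι e) * zeroExtend VD y (ι e) +
          zeroExtend VD x (τ e) * zeroExtend VD y (τ e)) -
        k e * (zeroExtend VD x (ι e) * zeroExtend VD y (τ e) +
          zeroExtend VD x (τ e) * zeroExtend VD y (ι e))) :=
  dotProduct_edgeFormMatrix_mulVec _ _ c k x y

theorem dotProduct_dnMatrix_mulVec_pos_of_laplacian (hconn : IsConnectedGraph ι τ)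
    (hVD : VD.Nonempty) {c : E → ℝ} (hc : ∀ e, 0 < c e) {z : {v // v ∉ VD} → ℝ} (hz : z ≠ 0) :
    0 < z ⬝ᵥ dnMatrix ι τ VD c c *ᵥ z := by
  have hterm : z ⬝ᵥ dnMatrix ι τ VD c c *ᵥ z =
      ∑ e, c e * (zeroExtend VD z (ι e) - zeroExtend VD z (τ e)) ^ 2 := by
    rw [dotProduct_dnMatrix_mulVec]
    refine Finset.sum_congr rfl fun e _ => ?_
    ring
  have hnonneg : ∀ e ∈ Finset.univ,
      0 ≤ c e * (zeroExtend VD z (ι e) - zeroExtend VD z (τ e)) ^ 2 := fun e _ =>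
    mul_nonneg (hc e).le (sq_nonneg _)
  rw [hterm]
  refine (Finset.sum_nonneg hnonneg).lt_of_ne' fun h => hz ?_
  have hedge : ∀ e, zeroExtend VD z (ι e) = zeroExtend VD z (τ e) := fun e => by
    have := (Finset.sum_eq_zero_iff_of_nonneg hnonneg).1 h e (Finset.mem_univ e)
    simpa [(hc e).ne', sub_eq_zero] using this
  obtain ⟨d, hd⟩ := hVD
  ext w
  have hconst : zeroExtend VD z w = 0 := by
    generalize (w : V) = v
    induction hconn d v with
    | refl => exact zeroExtend_of_mem z hd
    | tail _ hadj ih =>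
      obtain ⟨e, ⟨h1, h2⟩ | ⟨h1, h2⟩⟩ := hadj
      · rw [← h2, ← hedge, h1, ih]
      · rw [← h1, hedge, h2, ih]
  rw [← zeroExtend_coe z w, hconst, Pi.zero_apply]

theorem dotProduct_dnMatrix_mulVec_neg (hconn : IsConnectedGraph ι τ)
    (hVD : VD.Nonempty) {c k : E → ℝ} (hck : ∀ e, |k e| < -c e) {z : {v // v ∉ VD} → ℝ}
    (hz : z ≠ 0) : z ⬝ᵥ dnMatrix ι τ VD c k *ᵥ z < 0 := by
  obtain ⟨e₀, he₀⟩ := exists_zeroExtend_ne_zero hconn hVD hz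
  have hbound : ∀ (e : E) (a b : ℝ), c e * (a * a + b * b) - k e * (a * b + b * a) ≤
      (c e + |k e|) * (a ^ 2 + b ^ 2) := fun e a b => by
    nlinarith [le_abs_self (k e), neg_abs_le (k e), sq_nonneg (a + b), sq_nonneg (a - b)]
  rw [dotProduct_dnMatrix_mulVec]
  refine Finset.sum_neg' (fun e _ => (hbound e _ _).trans ?_)
    ⟨e₀, Finset.mem_univ _, (hbound e₀ _ _).trans_lt ?_⟩
  · exact mul_nonpos_of_nonpos_of_nonneg (by linarith [hck e]) (by positivity)
  · refine mul_neg_of_neg_of_pos (by linarith [hck e₀]) ?_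
    rcases he₀ with h | h <;> positivity

theorem eq_zero_of_dnMatrix_mulVec_eq_zero (hnl : ∀ e, ι e ≠ τ e) (hconn : IsConnectedGraph ι τ)
    (hdeg : ∀ v ∈ VD, graphDegree ι τ v = 1) {c k : E → ℝ} (hk : ∀ e, 0 < k e)
    (hpsd : (dnMatrix ι τ VD c k).PosSemidef) {z : {v // v ∉ VD} → ℝ}
    (hz : dnMatrix ι τ VD c k *ᵥ z = 0) {w₀ : {v // v ∉ VD}} (hw₀ : z w₀ = 0) : z = 0 := by
  set y : {v // v ∉ VD} → ℝ := fun w => |z w| with hy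
  have hyz : ∀ v, zeroExtend VD y v = |zeroExtend VD z v| := zeroExtend_abs z
  have hyker : dnMatrix ι τ VD c k *ᵥ y = 0 := by
    rw [← hpsd.dotProduct_mulVec_zero_iff, star_trivial]
    refine le_antisymm ?_ (by simpa using hpsd.dotProduct_mulVec_nonneg y)
    calc y ⬝ᵥ dnMatrix ι τ VD c k *ᵥ y ≤ z ⬝ᵥ dnMatrix ι τ VD c k *ᵥ z := by
          rw [dotProduct_dnMatrix_mulVec, dotProduct_dnMatrix_mulVec]
          refine Finset.sum_le_sum fun e _ => ?_
          simp only [hyz, abs_mul_abs_self, ← abs_mul]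
          have := le_abs_self (zeroExtend VD z (ι e) * zeroExtend VD z (τ e))
          have := le_abs_self (zeroExtend VD z (τ e) * zeroExtend VD z (ι e))
          have := hk e
          gcongr
      _ = 0 := by rw [hz, dotProduct_zero]
  have hstep : ∀ v u, v ∉ VD → zeroExtend VD z v = 0 → GraphAdj ι τ v u →
      zeroExtend VD z u = 0 := by
    intro v u hv hzv ⟨f, hf⟩
    have hsum : Pi.single (⟨v, hv⟩ : {v // v ∉ VD}) (1 : ℝ) ⬝ᵥ dnMatrix ι τ VD c k *ᵥ y = 0 := by
      rw [hyker, dotProduct_zero]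
    rw [dotProduct_dnMatrix_mulVec] at hsum
    have hterm : ∀ e, c e * (zeroExtend VD (Pi.single (⟨v, hv⟩ : {v // v ∉ VD}) 1) (ι e) *
        zeroExtend VD y (ι e) + zeroExtend VD (Pi.single (⟨v, hv⟩ : {v // v ∉ VD}) 1) (τ e) *
        zeroExtend VD y (τ e)) = 0 := fun e => by
      simp only [zeroExtend_single]
      split_ifs with h1 h2 h2 <;> simp [h1, h2, hyz, hzv]
    simp only [hterm, zero_sub, Finset.sum_neg_distrib, neg_eq_zero] at hsum
    have hnonneg : ∀ e, 0 ≤ zeroExtend VD (Pi.single (⟨v, hv⟩ : {v // v ∉ VD}) 1) (ι e) *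
        zeroExtend VD y (τ e) ∧ 0 ≤ zeroExtend VD (Pi.single (⟨v, hv⟩ : {v // v ∉ VD}) 1) (τ e) *
        zeroExtend VD y (ι e) := fun e => by
      simp only [zeroExtend_single, hyz]
      constructor <;> split_ifs <;> simp
    have hf0 := (Finset.sum_eq_zero_iff_of_nonneg fun e _ =>
      mul_nonneg (hk e).le (add_nonneg (hnonneg e).1 (hnonneg e).2)).1 hsum f (Finset.mem_univ f)
    rw [mul_eq_zero_iff_left (hk f).ne', add_eq_zero_iff_of_nonneg (hnonneg f).1 (hnonneg f).2]
      at hf0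
    simp only [zeroExtend_single, hyz] at hf0
    rcases hf with ⟨h1, h2⟩ | ⟨h1, h2⟩
    · simpa [h1, h2] using hf0.1
    · simpa [h1, h2] using hf0.2
  have hall : ∀ u, zeroExtend VD z u = 0 ∧
      (u ∈ VD → ∀ x, GraphAdj ι τ u x → zeroExtend VD z x = 0) := by
    intro u
    induction hconn w₀ u with
    | refl => exact ⟨(zeroExtend_coe z w₀).trans hw₀, fun h => absurd h w₀.2⟩
    | @tail v u _ hadj ih =>
      have hu : zeroExtend VD z u = 0 := by
        by_cases hv : v ∈ VD
        · exact ih.2 hv u hadj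
        · exact hstep v u hv ih.1 hadj
      refine ⟨hu, fun huD x hx => ?_⟩
      rw [eq_of_graphAdj_of_graphDegree_eq_one hnl (hdeg u huD) hx hadj.symm, ih.1]
  ext w
  rw [← zeroExtend_coe z w, (hall w).1, Pi.zero_apply]

end dnMatrix

/-- The Dirichlet-to-Neumann matrix of the metric graph at frequency `ω`. -/
def dnFamily {V E : Type} [Fintype E] (ι τ : E → V) (VD : Set V) (ℓ : E → ℝ) (ω : ℝ) :
    Matrix {v // v ∉ VD} {v // v ∉ VD} ℝ :=
  dnMatrix ι τ VD (fun e => Real.cos (ℓ e * ω) / Real.sin (ℓ e * ω))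
    (fun e => (Real.sin (ℓ e * ω))⁻¹)

theorem sin_pos_of_lt_pi {l t : ℝ} (hl : 0 < l) (ht : 0 < t) (h : l * t < Real.pi) :
    0 < Real.sin (l * t) :=
  Real.sin_pos_of_pos_of_lt_pi (mul_pos hl ht) h

theorem hasDerivAt_cos_div_sin {l x : ℝ} (h : Real.sin (l * x) ≠ 0) :
    HasDerivAt (fun t => Real.cos (l * t) / Real.sin (l * t)) (-l / Real.sin (l * x) ^ 2) x := by
  have hl : HasDerivAt (fun t => l * t) l x := by simpa using (hasDerivAt_id x).const_mul l
  refine (hl.cos.fun_div hl.sin h).congr_deriv ?_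
  congr 1
  linear_combination (-l) * Real.sin_sq_add_cos_sq (l * x)

theorem hasDerivAt_inv_sin {l x : ℝ} (h : Real.sin (l * x) ≠ 0) :
    HasDerivAt (fun t => (Real.sin (l * t))⁻¹)
      (-(l * Real.cos (l * x)) / Real.sin (l * x) ^ 2) x := by
  have hl : HasDerivAt (fun t => l * t) l x := by simpa using (hasDerivAt_id x).const_mul l
  refine (hl.sin.fun_inv h).congr_deriv ?_
  ring

section dnFamily

variable {V E : Type} [Fintype V] [Fintype E] {ι τ : E → V} {VD : Set V} {ℓ : E → ℝ}

theorem det_secA {ω : ℝ} (h : ∀ e, Real.sin (ℓ e * ω) ≠ 0) :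
    (secA ι τ VD ℓ ω).det = (∏ e, Real.sin (ℓ e * ω)) * (dnFamily ι τ VD ℓ ω).det :=
  det_secMatrix ι τ VD _ _ h fun _ => Real.cos_sq_add_sin_sq _

theorem dotProduct_dnFamily_mulVec_pos (hconn : IsConnectedGraph ι τ) (hVD : VD.Nonempty)
    (hℓ : ∀ e, 0 < ℓ e) {ω : ℝ} (hω : 0 < ω) (hπ : ∀ e, ℓ e * ω < Real.pi)
    (hdet : ∀ t ∈ Set.Ioc 0 ω, (dnFamily ι τ VD ℓ t).det ≠ 0) {z : {v // v ∉ VD} → ℝ}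
    (hz : z ≠ 0) : 0 < z ⬝ᵥ dnFamily ι τ VD ℓ ω *ᵥ z := by
  let M : ℝ → Matrix {v // v ∉ VD} {v // v ∉ VD} ℝ := fun t =>
    dnMatrix ι τ VD (fun e => Real.cos (ℓ e * t) * (ℓ e * Real.sinc (ℓ e * t))⁻¹)
      (fun e => (ℓ e * Real.sinc (ℓ e * t))⁻¹)
  have hM : ∀ t, t ≠ 0 → M t = t • dnFamily ι τ VD ℓ t := fun t ht => by
    rw [dnFamily, ← dnMatrix_smul]
    have h : ∀ e, (ℓ e * Real.sinc (ℓ e * t))⁻¹ = t * (Real.sin (ℓ e * t))⁻¹ := fun e => by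
      have := (hℓ e).ne'
      rw [Real.sinc_of_ne_zero (mul_ne_zero this ht)]
      field_simp
    simp only [M, h]
    congr 1
    ext e
    simp only [Pi.smul_apply, smul_eq_mul]
    ring
  have hM0 : M 0 = dnMatrix ι τ VD (fun e => (ℓ e)⁻¹) (fun e => (ℓ e)⁻¹) := by
    simp [M]
  have hsinc : ∀ e, ∀ t ∈ Set.Icc 0 ω, ℓ e * Real.sinc (ℓ e * t) ≠ 0 := fun e t ht => by
    refine mul_ne_zero (hℓ e).ne' ?_
    rcases ht.1.eq_or_lt with rfl | h0
    · simp
    · rw [Real.sinc_of_ne_zero (mul_pos (hℓ e) h0).ne']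
      refine div_ne_zero (sin_pos_of_lt_pi (hℓ e) h0 ?_).ne' (mul_pos (hℓ e) h0).ne'
      exact (mul_le_mul_of_nonneg_left ht.2 (hℓ e).le).trans_lt (hπ e)
  have hinv : ∀ e, ContinuousOn (fun t => (ℓ e * Real.sinc (ℓ e * t))⁻¹) (Set.Icc 0 ω) :=
    fun e => ContinuousOn.inv₀ (Continuous.continuousOn (by fun_prop)) (hsinc e)
  have hpos : 0 < z ⬝ᵥ M ω *ᵥ z := by
    refine dotProduct_mulVec_pos_of_det_ne_zero (M := M) hω.le ?_
      (fun t => dnMatrix_isSymm _ _) ?_ ?_ hz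
    · exact continuousOn_dnMatrix
        (fun e => (Continuous.continuousOn (by fun_prop)).mul (hinv e)) hinv
    · intro y hy
      rw [hM0]
      exact dotProduct_dnMatrix_mulVec_pos_of_laplacian hconn hVD (fun e => inv_pos.2 (hℓ e)) hy
    · intro t ht
      rcases ht.1.eq_or_lt with rfl | h0
      · intro h
        obtain ⟨y, hy, hy0⟩ := exists_mulVec_eq_zero_iff.2 h
        have := dotProduct_dnMatrix_mulVec_pos_of_laplacian hconn hVD
          (fun e => inv_pos.2 (hℓ e)) hy
        rw [← hM0, hy0, dotProduct_zero] at this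
        exact this.false
      · rw [hM t h0.ne', det_smul]
        exact mul_ne_zero (pow_ne_zero _ h0.ne') (hdet t ⟨h0, ht.2⟩)
  rw [hM ω hω.ne', smul_mulVec, dotProduct_smul, smul_eq_mul] at hpos
  exact pos_of_mul_pos_right hpos hω.le

theorem mul_lt_pi_of_det_dnFamily_ne_zero (hnl : ∀ e, ι e ≠ τ e) (hconn : IsConnectedGraph ι τ)
    (hVD : VD.Nonempty) (hdeg : ∀ v ∈ VD, graphDegree ι τ v = 1) (hne : VDᶜ.Nonempty)
    (hℓ : ∀ e, 0 < ℓ e) {ω₀ : ℝ}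
    (hdet : ∀ t, 0 < t → t < ω₀ → (∀ e, ℓ e * t < Real.pi) → (dnFamily ι τ VD ℓ t).det ≠ 0)
    (e : E) :
    ℓ e * ω₀ < Real.pi := by
  by_contra! hcon
  obtain ⟨m, -, hm⟩ := Finset.exists_max_image Finset.univ ℓ ⟨e, Finset.mem_univ e⟩
  replace hm : ∀ f, ℓ f ≤ ℓ m := fun f => hm f (Finset.mem_univ f)
  obtain ⟨v, hv, hmv⟩ : ∃ v ∉ VD, ι m = v ∨ τ m = v := by
    by_contra! h
    obtain ⟨u, hu⟩ := hne
    have h1 : ι m ∈ VD := by by_contra h1; exact (h _ h1).1 rfl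
    have h2 : τ m ∈ VD := by by_contra h2; exact (h _ h2).2 rfl
    rcases eq_endpoint_of_mem_dirichlet hnl hconn hdeg h1 h2 u with rfl | rfl
    · exact hu h1
    · exact hu h2
  set T := Real.pi / ℓ m with hT
  have hTpos : 0 < T := div_pos Real.pi_pos (hℓ m)
  have hmT : ℓ m * T = Real.pi := mul_div_cancel₀ _ (hℓ m).ne'
  have hω₀ : 0 < ω₀ := pos_of_mul_pos_right (Real.pi_pos.trans_le hcon) (hℓ e).le
  have hTω : T ≤ ω₀ := by
    rw [hT, div_le_iff₀' (hℓ m)]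
    exact hcon.trans (mul_le_mul_of_nonneg_right (hm e) hω₀.le)
  have hlt : ∀ t, 0 < t → t < T → ∀ f, ℓ f * t < Real.pi := fun t h0 ht f => by
    rw [← hmT]
    exact (mul_le_mul_of_nonneg_right (hm f) h0.le).trans_lt (mul_lt_mul_of_pos_left ht (hℓ m))
  let d : E → ℝ := fun f => (if ι f = v then 1 else 0) + (if τ f = v then 1 else 0)
  have hd : ∀ f, 0 ≤ d f := fun f => by
    simp only [d]; split_ifs <;> norm_num
  have hdm : 0 < d m := by
    simp only [d]
    rcases hmv with h | h <;> simp only [h, if_true] <;> split_ifs <;> norm_num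
  have hpos : ∀ t, 0 < t → t < T →
      0 < ∑ f, Real.cos (ℓ f * t) / Real.sin (ℓ f * t) * Real.sin (ℓ m * t) * d f := by
    intro t h0 ht
    have hq := dotProduct_dnFamily_mulVec_pos hconn hVD hℓ h0 (hlt t h0 ht)
      (fun s hs => hdet s hs.1 (hs.2.trans_lt (ht.trans_le hTω))
        (hlt s hs.1 (hs.2.trans_lt ht)))
      (z := Pi.single (⟨v, hv⟩ : {v // v ∉ VD}) 1) (by simp)
    rw [dnFamily, dotProduct_dnMatrix_mulVec] at hq
    have := mul_pos hq (sin_pos_of_lt_pi (hℓ m) h0 (hlt t h0 ht m))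
    rw [Finset.sum_mul] at this
    refine this.trans_eq (Finset.sum_congr rfl fun f _ => ?_)
    simp only [zeroExtend_single, d]
    have := hnl f
    split_ifs with h1 h2
    · exact absurd (h1.trans h2.symm) this
    all_goals ring
  have hlim : Tendsto
      (fun t => ∑ f, Real.cos (ℓ f * t) / Real.sin (ℓ f * t) * Real.sin (ℓ m * t) * d f)
      (𝓝[<] T) (𝓝 (∑ f, (if ℓ f = ℓ m then -1 else 0) * d f)) := by
    refine tendsto_finsetSum _ fun f _ => Tendsto.mul_const _ ?_
    split_ifs with hf
    · have hc : Tendsto (fun t => Real.cos (ℓ m * t)) (𝓝[<] T) (𝓝 (-1)) := by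
        have h : Continuous fun t => Real.cos (ℓ m * t) := by fun_prop
        have := h.tendsto T
        rw [hmT, Real.cos_pi] at this
        exact this.mono_left nhdsWithin_le_nhds
      refine hc.congr' ?_
      filter_upwards [Ioo_mem_nhdsLT hTpos] with t ht
      rw [hf, div_mul_cancel₀]
      exact (sin_pos_of_lt_pi (hℓ m) ht.1 (hlt t ht.1 ht.2 m)).ne'
    · have hs : Real.sin (ℓ f * T) ≠ 0 := (sin_pos_of_lt_pi (hℓ f) hTpos
        ((mul_lt_mul_of_pos_right (lt_of_le_of_ne (hm f) hf) hTpos).trans_eq hmT)).ne'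
      have h : ContinuousAt
          (fun t => Real.cos (ℓ f * t) / Real.sin (ℓ f * t) * Real.sin (ℓ m * t)) T :=
        (hasDerivAt_cos_div_sin hs).continuousAt.mul (by fun_prop)
      have := h.tendsto
      rw [hmT, Real.sin_pi, mul_zero] at this
      exact this.mono_left nhdsWithin_le_nhds
  have hge : 0 ≤ ∑ f, (if ℓ f = ℓ m then -1 else 0) * d f := by
    refine ge_of_tendsto hlim ?_
    filter_upwards [Ioo_mem_nhdsLT hTpos] with t ht
    exact (hpos t ht.1 ht.2).le
  refine hge.not_gt (Finset.sum_neg' (fun f _ => ?_) ⟨m, Finset.mem_univ m, by simpa using hdm⟩)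
  split_ifs
  · simpa using hd f
  · simp

theorem exists_mul_hasDerivAt_det_dnFamily (hnl : ∀ e, ι e ≠ τ e) (hconn : IsConnectedGraph ι τ)
    (hVD : VD.Nonempty) (hdeg : ∀ v ∈ VD, graphDegree ι τ v = 1) (w : {v // v ∉ VD})
    (hℓ : ∀ e, 0 < ℓ e) {ω₀ : ℝ} (hω₀ : 0 < ω₀) (hπ : ∀ e, ℓ e * ω₀ < Real.pi)
    (hzero : (dnFamily ι τ VD ℓ ω₀).det = 0)
    (hdet : ∀ t, 0 < t → t < ω₀ → (dnFamily ι τ VD ℓ t).det ≠ 0) :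
    ∃ a f' : ℝ, f' ≠ 0 ∧ HasDerivAt (fun t => (dnFamily ι τ VD ℓ t).det * a) f' ω₀ := by
  have hsin : ∀ e, 0 < Real.sin (ℓ e * ω₀) := fun e => sin_pos_of_lt_pi (hℓ e) hω₀ (hπ e)
  have hderiv : ∀ i j, HasDerivAt (fun t => dnFamily ι τ VD ℓ t i j) _ ω₀ :=
    hasDerivAt_dnMatrix_apply (fun e => hasDerivAt_cos_div_sin (hsin e).ne')
      (fun e => hasDerivAt_inv_sin (hsin e).ne')
  have hcont : ContinuousAt (dnFamily ι τ VD ℓ) ω₀ :=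
    continuousAt_pi.2 fun i => continuousAt_pi.2 fun j => (hderiv i j).continuousAt
  have hpsd : (dnFamily ι τ VD ℓ ω₀).PosSemidef := by
    refine PosSemidef.of_dotProduct_mulVec_nonneg ?_ fun z => ?_
    · exact (conjTranspose_eq_transpose_of_trivial _).trans (dnMatrix_isSymm _ _)
    · rw [star_trivial]
      by_cases hz : z = 0
      · simp [hz]
      have hq : Continuous fun A : Matrix {v // v ∉ VD} {v // v ∉ VD} ℝ => z ⬝ᵥ A *ᵥ z := by
        fun_prop
      refine ge_of_tendsto ((hq.continuousAt.comp hcont).tendsto.mono_left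
        (nhdsWithin_le_nhds (s := Set.Iio ω₀))) ?_
      filter_upwards [Ioo_mem_nhdsLT hω₀] with t ht
      refine (dotProduct_dnFamily_mulVec_pos hconn hVD hℓ ht.1 (fun e => ?_)
        (fun s hs => hdet s hs.1 (hs.2.trans_lt ht.2)) hz).le
      exact (mul_lt_mul_of_pos_left ht.2 (hℓ e)).trans (hπ e)
  have hadj : (dnFamily ι τ VD ℓ ω₀).adjugate w w ≠ 0 :=
    adjugate_diag_ne_zero hpsd w fun z hz hzw => eq_zero_of_dnMatrix_mulVec_eq_zero hnl hconn hdeg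
      (fun e => inv_pos.2 (hsin e)) hpsd hz hzw
  refine ⟨_, _, ?_, hasDerivAt_det_mul_adjugate hderiv (fun t => dnMatrix_isSymm _ _) hzero w⟩
  refine (dotProduct_dnMatrix_mulVec_neg hconn hVD (fun e => ?_) ?_).ne
  · have hs2 : 0 < Real.sin (ℓ e * ω₀) ^ 2 := pow_pos (hsin e) 2
    have hcos : |Real.cos (ℓ e * ω₀)| < 1 := by
      rw [← sq_lt_one_iff_abs_lt_one]
      linarith [Real.sin_sq_add_cos_sq (ℓ e * ω₀)]
    rw [abs_div, abs_neg, abs_mul, abs_of_pos (hℓ e), abs_of_pos hs2, neg_div, neg_neg]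
    exact div_lt_div_of_pos_right (mul_lt_of_lt_one_right (hℓ e) hcos) hs2
  · exact fun h => hadj (congrFun h w)

theorem exists_hasDerivAt_det_secA_of_forall_mem (hnl : ∀ e, ι e ≠ τ e)
    (hconn : IsConnectedGraph ι τ)
    (hVD : VD.Nonempty) (hdeg : ∀ v ∈ VD, graphDegree ι τ v = 1) (hall : ∀ v, v ∈ VD)
    (hℓ : ∀ e, 0 < ℓ e) {ω₀ : ℝ} (hzero : (secA ι τ VD ℓ ω₀).det = 0) :
    ∃ f' : ℝ, f' ≠ 0 ∧ HasDerivAt (fun t => (secA ι τ VD ℓ t).det) f' ω₀ := by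
  obtain ⟨d, hd⟩ := hVD
  obtain ⟨e, he⟩ : ∃ e, ι e = d ∨ τ e = d := by
    have h := hdeg d hd
    rw [graphDegree, Finset.card_eq_one] at h
    obtain ⟨e, he⟩ := h
    exact ⟨e, by simpa using he.ge (Finset.mem_singleton_self e)⟩
  have huniq : ∀ f, f = e := fun f => by
    rcases eq_endpoint_of_mem_dirichlet hnl hconn hdeg (hall _) (hall _) (ι f) with h | h
    · exact eq_of_graphDegree_eq_one (hdeg _ (hall (ι f))) (Or.inl rfl) (Or.inl h.symm)
    · exact eq_of_graphDegree_eq_one (hdeg _ (hall (ι f))) (Or.inl rfl) (Or.inr h.symm)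
  have hempty : IsEmpty {v // v ∉ VD} := ⟨fun w => w.2 (hall w)⟩
  have huniv : (Finset.univ : Finset E) = {e} := by ext f; simp [huniq f]
  have hsecA : ∀ t, Real.sin (ℓ e * t) ≠ 0 → (secA ι τ VD ℓ t).det = Real.sin (ℓ e * t) :=
    fun t ht => by
      rw [det_secA fun f => huniq f ▸ ht, det_isEmpty, mul_one, huniv, Finset.prod_singleton]
  have hsin0 : Real.sin (ℓ e * ω₀) = 0 := by
    by_contra h
    exact h ((hsecA ω₀ h).symm.trans hzero)
  have hl : HasDerivAt (fun t => ℓ e * t) (ℓ e) ω₀ := by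
    simpa using (hasDerivAt_id ω₀).const_mul (ℓ e)
  have hf' : Real.cos (ℓ e * ω₀) * ℓ e ≠ 0 := by
    refine mul_ne_zero (fun h => ?_) (hℓ e).ne'
    have := Real.sin_sq_add_cos_sq (ℓ e * ω₀)
    rw [h, hsin0] at this
    norm_num at this
  refine ⟨_, hf', hl.sin.congr_of_eventuallyEq ?_⟩
  have hev := hl.sin.eventually_ne (c := 0) hf'
  rw [eventually_nhdsWithin_iff] at hev
  filter_upwards [hev] with t ht
  by_cases h : t = ω₀
  · rw [h, hzero, hsin0]
  · exact hsecA t (ht h)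

end dnFamily

end

/-- At the ground state frequency `ω₀` (the smallest positive zero of the secular
function) of a connected graph with nonempty Dirichlet set (all Dirichlet vertices of
degree one), the secular function `ω ↦ det A_ω(G, V_D)` changes sign in every
neighbourhood of `ω₀`. -/
theorem det_secA_sign_change_at_ground_state {V E : Type} [Fintype V] [Fintype E]
    (ι τ : E → V) (hnl : ∀ e, ι e ≠ τ e)
    (hconn : IsConnectedGraph ι τ)
    (ℓ : E → ℝ) (hℓ : ∀ e, 0 < ℓ e)
    (VD : Set V) (hVD : VD.Nonempty)
    (hdeg : ∀ v ∈ VD, graphDegree ι τ v = 1)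
    (ω₀ : ℝ) (hω₀ : 0 < ω₀)
    (hzero : (secA ι τ VD ℓ ω₀).det = 0)
    (hmin : ∀ ω : ℝ, 0 < ω → ω < ω₀ → (secA ι τ VD ℓ ω).det ≠ 0) :
    ∀ ε > (0 : ℝ), ∃ ω₁ ω₂ : ℝ,
      ω₁ ∈ Set.Ioo (ω₀ - ε) (ω₀ + ε) ∧ ω₂ ∈ Set.Ioo (ω₀ - ε) (ω₀ + ε) ∧
      (secA ι τ VD ℓ ω₁).det * (secA ι τ VD ℓ ω₂).det < 0 := by
  intro ε hε
  obtain ⟨a, f', hf', hderiv⟩ : ∃ a f' : ℝ, f' ≠ 0 ∧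
      HasDerivAt (fun t => (secA ι τ VD ℓ t).det * a) f' ω₀ := by
    by_cases hall : ∀ v, v ∈ VD
    · obtain ⟨f', hf', h⟩ :=
        exists_hasDerivAt_det_secA_of_forall_mem hnl hconn hVD hdeg hall hℓ hzero
      exact ⟨1, f', hf', by simpa using h⟩
    push Not at hall
    obtain ⟨w, hw⟩ := hall
    have hdet : ∀ t, 0 < t → t < ω₀ → (∀ e, ℓ e * t < Real.pi) →
        (dnFamily ι τ VD ℓ t).det ≠ 0 := fun t h0 ht hπ h => by
      refine hmin t h0 ht ?_
      rw [det_secA fun e => (sin_pos_of_lt_pi (hℓ e) h0 (hπ e)).ne', h, mul_zero]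
    have hπ := mul_lt_pi_of_det_dnFamily_ne_zero hnl hconn hVD hdeg ⟨w, hw⟩ hℓ hdet
    have hsin : ∀ e, Real.sin (ℓ e * ω₀) ≠ 0 := fun e =>
      (sin_pos_of_lt_pi (hℓ e) hω₀ (hπ e)).ne'
    have hprod : ∏ e, Real.sin (ℓ e * ω₀) ≠ 0 := Finset.prod_ne_zero_iff.2 fun e _ => hsin e
    have hdn : (dnFamily ι τ VD ℓ ω₀).det = 0 := by
      rw [det_secA hsin] at hzero
      exact (mul_eq_zero.1 hzero).resolve_left hprod
    obtain ⟨a, f', hf', h⟩ := exists_mul_hasDerivAt_det_dnFamily hnl hconn hVD hdeg ⟨w, hw⟩ hℓ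
      hω₀ hπ hdn fun t h0 ht =>
        hdet t h0 ht fun e => (mul_lt_mul_of_pos_left ht (hℓ e)).trans (hπ e)
    have hcont : Continuous fun t => ∏ e, Real.sin (ℓ e * t) := by fun_prop
    refine ⟨a, _, mul_ne_zero hf' hprod, (h.mul_of_continuousAt_of_eq_zero (by simp [hdn])
      hcont.continuousAt).congr_of_eventuallyEq ?_⟩
    filter_upwards [hcont.continuousAt.eventually_ne hprod] with t ht
    rw [det_secA fun e => Finset.prod_ne_zero_iff.1 ht e (Finset.mem_univ e)]
    ring
  obtain ⟨ω₁, hω₁, ω₂, hω₂, hneg⟩ :=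
    exists_mul_neg_of_hasDerivAt hderiv (by rw [hzero, zero_mul]) hf' hε
  refine ⟨ω₁, ω₂, ⟨hω₁.1, by linarith [hω₁.2]⟩, ⟨by linarith [hω₂.1], hω₂.2⟩, ?_⟩
  by_contra! h
  nlinarith [mul_nonneg h (mul_self_nonneg a)]
end

section
/- For every ℓ > 0, every q ∈ ℝ, and every j ∈ ℕ (including j = 0) there exist constants a > 0 and C > 0 such that for all ω ≥ a: |(d/dω)^j [ sin(ℓ·√(ω² − q)) − sin(ℓω) ]| ≤ C/ω and |(d/dω)^j [ cos(ℓ·√(ω² − q)) − cos(ℓω) ]| ≤ C/ω, where (d/dω)^j denotes the j-th derivative with respect to ω (for j = 0 the function itself). -/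
open Filter Asymptotics Set

/-- The algebra of functions generated by the constants, `sin (ℓ √(ω² - q))`, `cos (ℓ √(ω² - q))`,
`1 / √(ω² - q)`, `√(ω² - q) - ω` and the differences with the free `sin` and `cos`, filtered by
the order `k` of decay `O(ω⁻ᵏ)` at infinity. -/
inductive PotentialSymbol (ℓ q : ℝ) : ℕ → (ℝ → ℝ) → Prop
  | const (c : ℝ) : PotentialSymbol ℓ q 0 fun _ => c
  | sin : PotentialSymbol ℓ q 0 fun ω => Real.sin (ℓ * √(ω ^ 2 - q))
  | cos : PotentialSymbol ℓ q 0 fun ω => Real.cos (ℓ * √(ω ^ 2 - q))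
  | inv : PotentialSymbol ℓ q 1 fun ω => (√(ω ^ 2 - q))⁻¹
  | shift : PotentialSymbol ℓ q 1 fun ω => √(ω ^ 2 - q) - ω
  | sinDiff : PotentialSymbol ℓ q 1 fun ω => Real.sin (ℓ * √(ω ^ 2 - q)) - Real.sin (ℓ * ω)
  | cosDiff : PotentialSymbol ℓ q 1 fun ω => Real.cos (ℓ * √(ω ^ 2 - q)) - Real.cos (ℓ * ω)
  | add {k : ℕ} {f g : ℝ → ℝ} (hf : PotentialSymbol ℓ q k f) (hg : PotentialSymbol ℓ q k g) :
      PotentialSymbol ℓ q k fun ω => f ω + g ω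
  | mul {k l : ℕ} {f g : ℝ → ℝ} (hf : PotentialSymbol ℓ q k f) (hg : PotentialSymbol ℓ q l g) :
      PotentialSymbol ℓ q (k + l) fun ω => f ω * g ω
  | lower {k : ℕ} {f : ℝ → ℝ} (hf : PotentialSymbol ℓ q (k + 1) f) : PotentialSymbol ℓ q k f

lemma sq_sub_pos_of_sqrt_abs_lt {q ω : ℝ} (hω : √|q| < ω) : 0 < ω ^ 2 - q := by
  have := (Real.sqrt_lt' ((Real.sqrt_nonneg _).trans_lt hω)).1 hω
  linarith [le_abs_self q]

lemma hasDerivAt_sqrt_sq_sub {q ω : ℝ} (hω : √|q| < ω) :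
    HasDerivAt (fun ω => √(ω ^ 2 - q)) (1 - (√(ω ^ 2 - q) - ω) * (√(ω ^ 2 - q))⁻¹) ω := by
  have hpos := sq_sub_pos_of_sqrt_abs_lt hω
  convert ((hasDerivAt_pow 2 ω).sub_const q).sqrt hpos.ne' using 1
  have := (Real.sqrt_pos.2 hpos).ne'
  field_simp
  ring

lemma abs_sqrt_sq_sub_sub_le {q ω : ℝ} (hω : √|q| < ω) :
    |√(ω ^ 2 - q) - ω| ≤ |q| * ω⁻¹ := by
  have hpos : 0 < ω := (Real.sqrt_nonneg _).trans_lt hω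
  have hsq := Real.sq_sqrt (sq_sub_pos_of_sqrt_abs_lt hω).le
  have hr := Real.sqrt_nonneg (ω ^ 2 - q)
  set r := √(ω ^ 2 - q)
  rw [← div_eq_mul_inv, le_div_iff₀ hpos]
  calc |r - ω| * ω ≤ |r - ω| * |r + ω| := by
        gcongr
        exact (le_add_of_nonneg_left hr).trans (le_abs_self _)
    _ = |q| := by
        rw [← abs_mul, ← abs_neg q]
        congr 1
        linear_combination hsq

lemma isBigO_inv_sqrt_sq_sub (q : ℝ) :
    (fun ω => (√(ω ^ 2 - q))⁻¹) =O[atTop] fun ω : ℝ => ω⁻¹ := by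
  refine IsBigO.of_bound 2 ?_
  filter_upwards [eventually_ge_atTop (1 + 2 * |q|)] with ω hω
  have hq := abs_nonneg q
  have hpos : 0 < ω := by linarith
  have hle : ω / 2 ≤ √(ω ^ 2 - q) := by
    apply Real.le_sqrt_of_sq_le
    nlinarith [le_abs_self q]
  rw [norm_inv, norm_inv, Real.norm_of_nonneg hpos.le, Real.norm_of_nonneg (Real.sqrt_nonneg _)]
  calc (√(ω ^ 2 - q))⁻¹ ≤ (ω / 2)⁻¹ := by gcongr
    _ = 2 * ω⁻¹ := by rw [inv_div, div_eq_mul_inv]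

lemma isBigO_sqrt_sq_sub_sub (q : ℝ) :
    (fun ω => √(ω ^ 2 - q) - ω) =O[atTop] fun ω : ℝ => ω⁻¹ := by
  refine IsBigO.of_bound |q| ?_
  filter_upwards [eventually_gt_atTop √|q|] with ω hω
  rw [norm_inv, Real.norm_of_nonneg ((Real.sqrt_nonneg _).trans hω.le)]
  exact abs_sqrt_sq_sub_sub_le hω

lemma LipschitzWith.isBigO_comp_sqrt_sq_sub {φ : ℝ → ℝ} (hφ : LipschitzWith 1 φ) (ℓ q : ℝ) :
    (fun ω => φ (ℓ * √(ω ^ 2 - q)) - φ (ℓ * ω)) =O[atTop] fun ω : ℝ => ω⁻¹ := by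
  refine IsBigO.trans (IsBigO.of_bound |ℓ| (Eventually.of_forall fun ω => ?_))
    (isBigO_sqrt_sq_sub_sub q)
  have h := hφ.dist_le_mul (ℓ * √(ω ^ 2 - q)) (ℓ * ω)
  rwa [NNReal.coe_one, one_mul, Real.dist_eq, Real.dist_eq, ← mul_sub, abs_mul] at h

namespace PotentialSymbol

variable {ℓ q : ℝ} {k : ℕ} {f : ℝ → ℝ}

lemma isBigO (hf : PotentialSymbol ℓ q k f) : f =O[atTop] fun ω => ω⁻¹ ^ k := by
  induction hf with
  | const c => simpa using isBigO_const_const c (one_ne_zero (α := ℝ)) (atTop : Filter ℝ)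
  | sin =>
    exact IsBigO.of_bound 1 (Eventually.of_forall fun ω => by simpa using Real.abs_sin_le_one _)
  | cos =>
    exact IsBigO.of_bound 1 (Eventually.of_forall fun ω => by simpa using Real.abs_cos_le_one _)
  | inv => simpa using isBigO_inv_sqrt_sq_sub q
  | shift => simpa using isBigO_sqrt_sq_sub_sub q
  | sinDiff => simpa using Real.lipschitzWith_sin.isBigO_comp_sqrt_sq_sub ℓ q
  | cosDiff => simpa using Real.lipschitzWith_cos.isBigO_comp_sqrt_sq_sub ℓ q
  | add _ _ hf hg => exact hf.add hg
  | mul _ _ hf hg => simpa only [pow_add] using hf.mul hg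
  | @lower k _ _ hf =>
    have hinv : (fun ω : ℝ => ω⁻¹) =O[atTop] fun _ => (1 : ℝ) :=
      tendsto_inv_atTop_zero.isBigO_one ℝ
    refine hf.trans ?_
    simpa only [pow_succ, mul_one] using (isBigO_refl (fun ω : ℝ => ω⁻¹ ^ k) atTop).mul hinv

lemma const_mul (c : ℝ) (hf : PotentialSymbol ℓ q k f) :
    PotentialSymbol ℓ q k fun ω => c * f ω := by
  simpa only [zero_add] using (const c).mul hf

/-- Each level of the filtration is stable under differentiation. -/
lemma exists_hasDerivAt (hf : PotentialSymbol ℓ q k f) :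
    ∃ f', PotentialSymbol ℓ q k f' ∧ ∀ ω, √|q| < ω → HasDerivAt f (f' ω) ω := by
  have hδu : PotentialSymbol ℓ q 1 fun ω => (√(ω ^ 2 - q) - ω) * (√(ω ^ 2 - q))⁻¹ :=
    (shift.mul inv).lower
  have hr (ω : ℝ) (hω : √|q| < ω) := (hasDerivAt_sqrt_sq_sub hω).const_mul ℓ
  have hlin (ω : ℝ) : HasDerivAt (fun ω => ℓ * ω) ℓ ω := by
    simpa using (hasDerivAt_id ω).const_mul ℓ
  induction hf with
  | const c => exact ⟨_, const 0, fun ω _ => hasDerivAt_const ω c⟩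
  | sin =>
    refine ⟨_, (cos.add ((hδu.lower.mul cos).const_mul (-1))).const_mul ℓ, fun ω hω => ?_⟩
    exact (hr ω hω).sin.congr_deriv (by ring)
  | cos =>
    refine ⟨_, (sin.add ((hδu.lower.mul sin).const_mul (-1))).const_mul (-ℓ), fun ω hω => ?_⟩
    exact (hr ω hω).cos.congr_deriv (by ring)
  | inv =>
    refine ⟨_, (((inv.mul inv).lower).const_mul (-1)).add
      (hδu.mul (inv.mul inv)).lower.lower, fun ω hω => ?_⟩
    have hne := (Real.sqrt_pos.2 (sq_sub_pos_of_sqrt_abs_lt hω)).ne'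
    refine ((hasDerivAt_sqrt_sq_sub hω).inv hne).congr_deriv ?_
    field_simp
    ring
  | shift =>
    refine ⟨_, hδu.const_mul (-1), fun ω hω => ?_⟩
    exact ((hasDerivAt_sqrt_sq_sub hω).sub (hasDerivAt_id ω)).congr_deriv (by ring)
  | sinDiff =>
    refine ⟨_, (cosDiff.add ((hδu.mul cos).const_mul (-1))).const_mul ℓ, fun ω hω => ?_⟩
    exact ((hr ω hω).sin.sub (hlin ω).sin).congr_deriv (by ring)
  | cosDiff =>
    refine ⟨_, (sinDiff.add ((hδu.mul sin).const_mul (-1))).const_mul (-ℓ), fun ω hω => ?_⟩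
    exact ((hr ω hω).cos.sub (hlin ω).cos).congr_deriv (by ring)
  | add _ _ hf hg =>
    obtain ⟨f', hf', hdf⟩ := hf
    obtain ⟨g', hg', hdg⟩ := hg
    exact ⟨_, hf'.add hg', fun ω hω => (hdf ω hω).add (hdg ω hω)⟩
  | mul hf₀ hg₀ hf hg =>
    obtain ⟨f', hf', hdf⟩ := hf
    obtain ⟨g', hg', hdg⟩ := hg
    exact ⟨_, (hf'.mul hg₀).add (hf₀.mul hg'), fun ω hω => (hdf ω hω).mul (hdg ω hω)⟩
  | lower _ hf =>
    obtain ⟨f', hf', hdf⟩ := hf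
    exact ⟨f', hf'.lower, hdf⟩

lemma exists_iteratedDeriv_eqOn (hf : PotentialSymbol ℓ q k f) (n : ℕ) :
    ∃ g, PotentialSymbol ℓ q k g ∧ EqOn (iteratedDeriv n f) g (Ioi √|q|) := by
  induction n with
  | zero => exact ⟨f, hf, fun ω _ => by rw [iteratedDeriv_zero]⟩
  | succ n ih =>
    obtain ⟨g, hg, hfg⟩ := ih
    obtain ⟨g', hg', hdg⟩ := hg.exists_hasDerivAt
    refine ⟨g', hg', fun ω hω => ?_⟩
    rw [iteratedDeriv_succ, (hfg.eventuallyEq_of_mem (isOpen_Ioi.mem_nhds hω)).deriv_eq]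
    exact (hdg ω hω).deriv

lemma isBigO_iteratedDeriv (hf : PotentialSymbol ℓ q k f) (n : ℕ) :
    iteratedDeriv n f =O[atTop] fun ω => ω⁻¹ ^ k := by
  obtain ⟨g, hg, hfg⟩ := hf.exists_iteratedDeriv_eqOn n
  exact hg.isBigO.congr' (hfg.eventuallyEq_of_mem (Ioi_mem_atTop _)).symm EventuallyEq.rfl

end PotentialSymbol

/-- For every edge length `ℓ > 0`, potential value `q ∈ ℝ` and order `j ∈ ℕ` (including
`j = 0`), there are constants `a > 0` (with `a > √|q|`, so that `ω² - q > 0` for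
`ω ≥ a`) and `C > 0` such that for all `ω ≥ a` the `j`-th derivatives of
`ω ↦ sin (ℓ √(ω² - q)) - sin (ℓ ω)` and `ω ↦ cos (ℓ √(ω² - q)) - cos (ℓ ω)` are bounded
by `C / ω`. -/
theorem deriv_bounds_sin_cos_potential (ℓ : ℝ) (hℓ : 0 < ℓ) (q : ℝ) (j : ℕ) :
    ∃ a C : ℝ, 0 < a ∧ 0 < C ∧ Real.sqrt |q| < a ∧
      ∀ ω : ℝ, a ≤ ω →
        |iteratedDeriv j
          (fun ω : ℝ => Real.sin (ℓ * Real.sqrt (ω ^ 2 - q)) - Real.sin (ℓ * ω)) ω|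
          ≤ C / ω ∧
        |iteratedDeriv j
          (fun ω : ℝ => Real.cos (ℓ * Real.sqrt (ω ^ 2 - q)) - Real.cos (ℓ * ω)) ω|
          ≤ C / ω := by
  obtain ⟨C₁, hC₁, hs⟩ :=
    ((PotentialSymbol.sinDiff (ℓ := ℓ) (q := q)).isBigO_iteratedDeriv j).exists_pos
  obtain ⟨C₂, hC₂, hc⟩ :=
    ((PotentialSymbol.cosDiff (ℓ := ℓ) (q := q)).isBigO_iteratedDeriv j).exists_pos
  obtain ⟨a, ha⟩ := eventually_atTop.1 (hs.bound.and hc.bound)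
  have hlt : √|q| < max a (√|q| + 1) := lt_max_of_lt_right (lt_add_one _)
  have hpos : 0 < max a (√|q| + 1) := (Real.sqrt_nonneg _).trans_lt hlt
  refine ⟨_, C₁ + C₂, hpos, add_pos hC₁ hC₂, hlt, fun ω hω => ?_⟩
  have hω₀ : 0 < ω := hpos.trans_le hω
  obtain ⟨h₁, h₂⟩ := ha ω ((le_max_left _ _).trans hω)
  rw [pow_one, norm_inv, Real.norm_of_nonneg hω₀.le, ← div_eq_mul_inv] at h₁ h₂
  exact ⟨h₁.trans (by gcongr; linarith), h₂.trans (by gcongr; linarith)⟩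
end

section
/- Let a > 0, let k ∈ ℕ (including k = 0), and let η : [a, ∞) → ℝ be a continuous, (2k+2)-times differentiable function whose (2k+2)-nd derivative is uniformly bounded on [a, ∞), and let α ≠ 0 be a real number. Then for every ε > 0 there exists δ > 0 such that for every x₀ ≥ a + ε the following implication holds: if max{ |η(x₀)|, |η'(x₀)|, …, |η^{(2k)}(x₀)|, |η^{(2k+1)}(x₀) − α| } ≤ δ, then η has a zero in the interval [x₀ − ε, x₀ + ε]. -/
open Set in
/-- Taylor's theorem with the Lagrange form of the remainder, with the derivatives taken within an
arbitrary order-connected set containing the base point and the evaluation point. -/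
theorem exists_eq_taylorWithinEval_add_lagrange {s : Set ℝ} (hs : s.OrdConnected)
    (hu : UniqueDiffOn ℝ s) {f : ℝ → ℝ} {n : ℕ} (hf : ContDiffOn ℝ n f s)
    (hf' : DifferentiableOn ℝ (iteratedDerivWithin n f s) s) {x₀ x : ℝ} (hx₀ : x₀ ∈ s)
    (hx : x ∈ s) (hne : x₀ ≠ x) :
    ∃ y ∈ s, f x = taylorWithinEval f n s x₀ x +
      iteratedDerivWithin (n + 1) f s y * (x - x₀) ^ (n + 1) / (n + 1).factorial := by
  have hsub : uIcc x₀ x ⊆ s := hs.uIcc_subset hx₀ hx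
  have hu' : UniqueDiffOn ℝ (uIcc x₀ x) := uniqueDiffOn_Icc (by simpa using hne.symm)
  have heq : ∀ j ≤ n, ∀ y ∈ uIcc x₀ x,
      iteratedDerivWithin j f (uIcc x₀ x) y = iteratedDerivWithin j f s y := fun j hj y hy => by
    rw [iteratedDerivWithin_eq_iteratedFDerivWithin, iteratedDerivWithin_eq_iteratedFDerivWithin,
      iteratedFDerivWithin_subset hsub hu' hu (hf.of_le (mod_cast hj)) hy]
  have hd : DifferentiableOn ℝ (iteratedDerivWithin n f (uIcc x₀ x)) (uIcc x₀ x) :=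
    (hf'.mono hsub).congr (heq n le_rfl)
  obtain ⟨y, hy, h⟩ := taylor_mean_remainder_lagrange hne (hf.mono hsub)
    (hd.mono Ioo_subset_Icc_self)
  have hy' : y ∈ uIcc x₀ x := Ioo_subset_Icc_self hy
  refine ⟨y, hsub hy', ?_⟩
  have hT : taylorWithinEval f n (uIcc x₀ x) x₀ x = taylorWithinEval f n s x₀ x := by
    simp only [taylor_within_apply]
    refine Finset.sum_congr rfl fun j hj => ?_
    rw [heq j (by simpa [Nat.lt_succ_iff] using hj) x₀ left_mem_uIcc]
  have hD : iteratedDerivWithin (n + 1) f (uIcc x₀ x) y = iteratedDerivWithin (n + 1) f s y := by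
    rw [iteratedDerivWithin_succ, iteratedDerivWithin_succ,
      derivWithin_congr (heq n le_rfl) (heq n le_rfl y hy'),
      derivWithin_subset hsub (hu' y hy') (hf' y (hsub hy'))]
  rw [← hT, ← hD]
  linarith

/-- If all derivatives of `f` at `x₀` up to order `n` are `δ`-close to `0, …, 0, α`, then near `x₀`
the function `f` is close to the monomial `α * (x - x₀) ^ n / n!`. -/
theorem abs_sub_monomial_le {s : Set ℝ} (hs : s.OrdConnected) (hu : UniqueDiffOn ℝ s)
    {f : ℝ → ℝ} {n : ℕ} (hf : ContDiffOn ℝ n f s)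
    (hf' : DifferentiableOn ℝ (iteratedDerivWithin n f s) s) {M : ℝ}
    (hM : ∀ y ∈ s, |iteratedDerivWithin (n + 1) f s y| ≤ M) {x₀ t α δ : ℝ} (hx₀ : x₀ ∈ s)
    (hx : x₀ + t ∈ s) (ht₀ : t ≠ 0) (ht : |t| ≤ 1)
    (hδ : ∀ j < n, |iteratedDerivWithin j f s x₀| ≤ δ)
    (hα : |iteratedDerivWithin n f s x₀ - α| ≤ δ) :
    |f (x₀ + t) - α * (t ^ n / n.factorial)| ≤
      (n + 1) * δ + M * |t| * (|t| ^ n / n.factorial) := by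
  obtain ⟨y, hy, h⟩ := exists_eq_taylorWithinEval_add_lagrange hs hu hf hf' hx₀ hx
    (by simpa using ht₀)
  have hδ₀ : 0 ≤ δ := (abs_nonneg _).trans hα
  have hterm : ∀ (j : ℕ) (c : ℝ), |c| ≤ δ → |((j.factorial : ℝ)⁻¹ * t ^ j) * c| ≤ δ := by
    intro j c hc
    have h1 : |(j.factorial : ℝ)⁻¹ * t ^ j| ≤ 1 := by
      rw [abs_mul, abs_pow, abs_of_nonneg (by positivity : (0 : ℝ) ≤ (j.factorial : ℝ)⁻¹)]
      exact mul_le_one₀ (inv_le_one_of_one_le₀ (mod_cast j.factorial_pos)) (by positivity)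
        (pow_le_one₀ (abs_nonneg t) ht)
    rw [abs_mul]
    nlinarith [abs_nonneg c]
  have hsum : |∑ j ∈ Finset.range n,
      ((j.factorial : ℝ)⁻¹ * t ^ j) * iteratedDerivWithin j f s x₀| ≤ n * δ := by
    refine (Finset.abs_sum_le_sum_abs _ _).trans ?_
    refine (Finset.sum_le_card_nsmul _ _ δ fun j hj =>
      hterm j _ (hδ j (Finset.mem_range.1 hj))).trans ?_
    simp
  have hlast := hterm n _ hα
  have hrem : |iteratedDerivWithin (n + 1) f s y * t ^ (n + 1) / (n + 1).factorial| ≤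
      M * |t| * (|t| ^ n / n.factorial) := by
    have h1 : (n.factorial : ℝ) ≤ (n + 1).factorial := mod_cast Nat.factorial_le n.le_succ
    have hM₀ : 0 ≤ M := (abs_nonneg _).trans (hM y hy)
    rw [abs_div, abs_mul, abs_pow, Nat.abs_cast]
    calc _ ≤ M * |t| ^ (n + 1) / n.factorial := by
          gcongr
          exact hM y hy
      _ = _ := by ring
  have hsplit : f (x₀ + t) - α * (t ^ n / n.factorial) =
      (∑ j ∈ Finset.range n, ((j.factorial : ℝ)⁻¹ * t ^ j) * iteratedDerivWithin j f s x₀) +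
      ((n.factorial : ℝ)⁻¹ * t ^ n) * (iteratedDerivWithin n f s x₀ - α) +
      iteratedDerivWithin (n + 1) f s y * t ^ (n + 1) / (n + 1).factorial := by
    rw [h, taylor_within_apply, Finset.sum_range_succ]
    simp only [add_sub_cancel_left, smul_eq_mul]
    ring
  rw [hsplit]
  refine (abs_add_three _ _ _).trans ?_
  linarith

/-- Taylor-type lemma: let `η : [a, ∞) → ℝ` be `(2k+2)`-times differentiable with
uniformly bounded `(2k+2)`-nd derivative, and let `α ≠ 0`.  Then for every `ε > 0` there
is `δ > 0` (independent of `x₀`) such that for every `x₀ ≥ a + ε`, if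
`|η(x₀)|, |η'(x₀)|, …, |η^{(2k)}(x₀)| ≤ δ` and `|η^{(2k+1)}(x₀) - α| ≤ δ`, then `η` has a
zero in `[x₀ - ε, x₀ + ε]`.  Derivatives are taken within `[a, ∞)`. -/
theorem taylor_zero_lemma (a : ℝ) (ha : 0 < a) (k : ℕ) (η : ℝ → ℝ) (α : ℝ) (hα : α ≠ 0)
    (hdiff : ∀ j ≤ 2 * k + 1,
      DifferentiableOn ℝ (iteratedDerivWithin j η (Set.Ici a)) (Set.Ici a))
    (M : ℝ) (hM : ∀ x ∈ Set.Ici a, |iteratedDerivWithin (2 * k + 2) η (Set.Ici a) x| ≤ M) :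
    ∀ ε > (0 : ℝ), ∃ δ > (0 : ℝ), ∀ x₀ : ℝ, a + ε ≤ x₀ →
      (∀ j ≤ 2 * k, |iteratedDerivWithin j η (Set.Ici a) x₀| ≤ δ) →
      |iteratedDerivWithin (2 * k + 1) η (Set.Ici a) x₀ - α| ≤ δ →
      ∃ x ∈ Set.Icc (x₀ - ε) (x₀ + ε), η x = 0 := by
  intro ε hε
  have hM₀ : 0 ≤ M := (abs_nonneg _).trans (hM a Set.self_mem_Ici)
  have hα' : 0 < |α| := abs_pos.2 hα
  have hcd : ContDiffOn ℝ ((2 * k + 1 : ℕ) : ℕ∞) η (Set.Ici a) :=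
    contDiffOn_of_differentiableOn_deriv fun j hj => hdiff j (by exact_mod_cast hj)
  obtain ⟨h, hh₀, hhε, hh1, hhM⟩ : ∃ h : ℝ, 0 < h ∧ h ≤ ε ∧ h ≤ 1 ∧ M * h ≤ |α| / 4 := by
    refine ⟨min ε (min 1 (|α| / 4 / (M + 1))), by positivity, min_le_left _ _,
      (min_le_right _ _).trans (min_le_left _ _), ?_⟩
    have h1 : min ε (min 1 (|α| / 4 / (M + 1))) ≤ |α| / 4 / (M + 1) :=
      (min_le_right _ _).trans (min_le_right _ _)
    have h2 : 0 < min ε (min 1 (|α| / 4 / (M + 1))) := by positivity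
    rw [le_div_iff₀ (by positivity)] at h1
    linarith
  have hA : 0 < h ^ (2 * k + 1) / (2 * k + 1).factorial := by positivity
  set A : ℝ := h ^ (2 * k + 1) / (2 * k + 1).factorial with hA_def
  refine ⟨|α| / 4 * A / ((2 * k + 1 : ℕ) + 1), by positivity, fun x₀ hx₀ hj hlast => ?_⟩
  have key : ∀ t : ℝ, |t| = h →
      |η (x₀ + t) - α * (t ^ (2 * k + 1) / (2 * k + 1).factorial)| ≤ |α| * A / 2 := by
    intro t ht
    have ht' := neg_abs_le t
    have hb := abs_sub_monomial_le Set.ordConnected_Ici (uniqueDiffOn_Ici a) hcd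
      (hdiff _ le_rfl) hM (t := t) (show a ≤ x₀ by linarith) (show a ≤ x₀ + t by linarith)
      (abs_pos.1 (ht ▸ hh₀)) (ht ▸ hh1) (fun j hjk => hj j (by omega)) hlast
    rw [ht, ← hA_def, mul_div_cancel₀ _ (by positivity)] at hb
    nlinarith
  have hr := key h (abs_of_pos hh₀)
  have hl := key (-h) (by rw [abs_neg, abs_of_pos hh₀])
  rw [Odd.neg_pow ⟨k, rfl⟩, neg_div, ← hA_def] at hl
  rw [← hA_def] at hr
  have hzero : (0 : ℝ) ∈ Set.uIcc (η (x₀ + -h)) (η (x₀ + h)) := by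
    rw [abs_le] at hl hr
    rw [Set.mem_uIcc]
    rcases abs_cases α with ⟨hc, -⟩ | ⟨hc, -⟩
    · left
      have := mul_pos hα' hA
      rw [hc] at hl hr this
      constructor <;> linarith
    · right
      have := mul_pos hα' hA
      rw [hc] at hl hr this
      constructor <;> linarith
  have hle : x₀ + -h ≤ x₀ + h := by linarith
  have hcont : ContinuousOn η (Set.uIcc (x₀ + -h) (x₀ + h)) := by
    refine hcd.continuousOn.mono fun y hy => ?_
    rw [Set.uIcc_of_le hle] at hy
    exact show a ≤ y by linarith [hy.1]
  obtain ⟨y, hy, hy0⟩ := intermediate_value_uIcc hcont hzero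
  rw [Set.uIcc_of_le hle] at hy
  exact ⟨y, ⟨by linarith [hy.1], by linarith [hy.2]⟩, hy0⟩
end
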